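/- arXiv:2501.10354 — 12 statements merged into one kernel-verified Lean document; each statement's English description precedes it below -/
import Mathlib

section
/- Let n, d, r, t, q be positive integers with q ≥ 2 and n ≥ max{r+1, d−1}, and assume M₀ := ⌈n·p₁(r,t)⌉ ≥ 2. Let C be a set of words of length n over an alphabet of size q such that: (a) any two distinct codewords of C have Hamming distance at least d; (b) every coordinate j ∈ [n] is assigned t subsets Γ₁(j),…,Γ_t(j) ⊆ [n] with j ∈ Γ_α(j), |Γ_α(j)| ≤ r+1 for all α, and Γ_α(j) ∩ Γ_β(j) = {j} for all α ≠ β; and (c) for every j ∈ [n], every α ∈ [t], and all c₁, c₂ ∈ C with c₁(j) ≠ c₂(j), the restrictions of c₁ and c₂ to Γ_α(j)∖{j} differ. Then (d−1) + N₁(n,r,d,M₀) ≤ n and |C| ≤ q^{n−(d−1)−N₁(n,r,d,M₀)}. -/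
/-- `p₁(r,t) = 1 − 1/∏_{l=1}^{t}(1 + 1/(l·r))`. -/
def p1 (r t : ℕ) : ℚ :=
  1 - 1 / ∏ l ∈ Finset.Icc 1 t, (1 + 1 / ((l : ℚ) * (r : ℚ)))

/-- `N₁(n,r,d,M)`: the largest integer `N` with `0 ≤ N ≤ M` such that
`N(r+1) − [N(N−1)/(M(M−1))]·(M(r+1)−n) ≤ n−(d−1)` as rational numbers. -/
def N1 (n r d M : ℕ) : ℕ :=
  ((Finset.range (M + 1)).filter (fun N : ℕ =>
    (N : ℚ) * ((r : ℚ) + 1) -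
      ((N : ℚ) * ((N : ℚ) - 1)) / ((M : ℚ) * ((M : ℚ) - 1)) *
        ((M : ℚ) * ((r : ℚ) + 1) - (n : ℚ))
      ≤ (n : ℚ) - ((d : ℚ) - 1))).sup id

open Finset in
/-- Among the relative orders of `insert j A` under a uniformly random permutation, `j` comes last
with probability `1 / (|A| + 1)`. -/
theorem card_perm_forall_lt_mul {n : ℕ} (j : Fin n) (A : Finset (Fin n)) (hj : j ∉ A) :
    #{σ : Equiv.Perm (Fin n) | ∀ i ∈ A, σ i < σ j} * (#A + 1) = n.factorial := by
  set s := insert j A with hs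
  have hcard : #s = #A + 1 := card_insert_of_notMem hj
  have hlt : ∀ σ : Equiv.Perm (Fin n), (∀ i ∈ A, σ i < σ j) ↔ ∀ i ∈ s, σ i ≤ σ j := by
    intro σ
    simp only [hs, forall_mem_insert, le_refl, true_and]
    refine forall₂_congr fun i hi => ⟨le_of_lt, fun h => lt_of_le_of_ne h fun h' => ?_⟩
    exact hj (σ.injective h' ▸ hi)
  have hsymm : ∀ k ∈ s, #{σ : Equiv.Perm (Fin n) | ∀ i ∈ s, σ i ≤ σ k} =
      #{σ : Equiv.Perm (Fin n) | ∀ i ∈ s, σ i ≤ σ j} := by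
    intro k hk
    have hswap : ∀ i ∈ s, Equiv.swap j k i ∈ s := by
      intro i hi
      by_cases h1 : i = j
      · simpa [h1] using hk
      by_cases h2 : i = k
      · simp [h2, hs]
      · rwa [Equiv.swap_apply_of_ne_of_ne h1 h2]
    refine card_nbij' (fun σ => σ * Equiv.swap j k) (fun σ => σ * Equiv.swap j k) ?_ ?_ ?_ ?_
    · intro σ hσ
      simp only [coe_filter, mem_univ, true_and, Set.mem_ofPred_eq, Equiv.Perm.mul_apply,
        Equiv.swap_apply_left] at hσ ⊢
      exact fun i hi => hσ _ (hswap i hi)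
    · intro σ hσ
      simp only [coe_filter, mem_univ, true_and, Set.mem_ofPred_eq, Equiv.Perm.mul_apply,
        Equiv.swap_apply_right] at hσ ⊢
      exact fun i hi => hσ _ (hswap i hi)
    · intro σ _
      simp [mul_assoc]
    · intro σ _
      simp [mul_assoc]
  have htotal : ∑ k ∈ s, #{σ : Equiv.Perm (Fin n) | ∀ i ∈ s, σ i ≤ σ k} = n.factorial := by
    rw [← card_biUnion]
    · have : (s.biUnion fun k => ({σ | ∀ i ∈ s, σ i ≤ σ k} : Finset (Equiv.Perm (Fin n)))) =
          univ := by
        ext σ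
        simpa using exists_max_image s σ ⟨j, mem_insert_self j A⟩
      rw [this, card_univ, Fintype.card_perm, Fintype.card_fin]
    · intro k hk l hl hkl
      refine disjoint_left.2 fun σ h1 h2 => hkl ?_
      simp only [mem_filter, mem_univ, true_and] at h1 h2
      exact σ.injective (le_antisymm (h2 k hk) (h1 l hl))
  rw [← htotal, sum_congr rfl hsymm, sum_const, smul_eq_mul, hcard, mul_comm]
  simp_rw [hlt]

open Finset in
/-- The expected value, over a random permutation, of the indicator that none of the disjoint
sets `A a` lies entirely before `j`. -/
theorem sum_perm_prod_eq_integral {n t : ℕ} (j : Fin n) (A : Fin t → Finset (Fin n))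
    (hj : ∀ a, j ∉ A a) (hA : ∀ a b, a ≠ b → Disjoint (A a) (A b)) :
    ∑ σ : Equiv.Perm (Fin n), ∏ a, (1 - if ∀ i ∈ A a, σ i < σ j then (1 : ℝ) else 0) =
      n.factorial * ∫ x in (0 : ℝ)..1, ∏ a, (1 - x ^ #(A a)) := by
  have hexp : ∀ f : Fin t → ℝ,
      ∏ a, (1 - f a) = ∑ B : Finset (Fin t), (-1) ^ #B * ∏ a ∈ B, f a := by
    intro f
    simp_rw [sub_eq_add_neg, prod_one_add, powerset_univ, prod_neg]
  simp_rw [hexp]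
  rw [sum_comm, intervalIntegral.integral_finsetSum]
  · rw [mul_sum]
    refine sum_congr rfl fun B _ => ?_
    have hunion : #(B.biUnion A) = ∑ a ∈ B, #(A a) :=
      card_biUnion fun a _ b _ hab => hA a b hab
    have hind : ∀ σ : Equiv.Perm (Fin n),
        (∏ a ∈ B, if ∀ i ∈ A a, σ i < σ j then (1 : ℝ) else 0) =
          if ∀ i ∈ B.biUnion A, σ i < σ j then 1 else 0 := by
      intro σ
      rw [prod_ite_zero]
      simp only [prod_const_one, mem_biUnion]
      congr 1
      simp only [eq_iff_iff]
      exact ⟨fun h i ⟨a, ha, hi⟩ => h a ha i hi, fun h a ha i hi => h i ⟨a, ha, hi⟩⟩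
    have hcount := card_perm_forall_lt_mul j (B.biUnion A) (by simpa using fun a _ => hj a)
    simp_rw [hind, prod_pow_eq_pow_sum, ← hunion]
    rw [← mul_sum, sum_boole, intervalIntegral.integral_const_mul, integral_pow, ← hcount]
    push_cast
    field_simp
    simp
  · intro B _
    exact Continuous.intervalIntegrable (by fun_prop) _ _

theorem integral_one_sub_pow_pow (r t : ℕ) (hr : 0 < r) :
    ∫ x in (0 : ℝ)..1, (1 - x ^ r) ^ t =
      1 / ∏ l ∈ Finset.Icc 1 t, (1 + 1 / ((l : ℝ) * (r : ℝ))) := by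
  induction t with
  | zero => simp
  | succ t ih =>
    have hr' : (0 : ℝ) < r := by exact_mod_cast hr
    have hderiv : ∀ x : ℝ, HasDerivAt (fun x : ℝ => x * (1 - x ^ r) ^ (t + 1))
        ((1 + (t + 1) * r) * (1 - x ^ r) ^ (t + 1) - (t + 1) * r * (1 - x ^ r) ^ t) x := by
      intro x
      have h := (hasDerivAt_id x).mul (((hasDerivAt_pow r x).const_sub 1).pow (t + 1))
      refine h.congr_deriv ?_
      obtain ⟨m, rfl⟩ := Nat.exists_eq_succ_of_ne_zero hr.ne'
      simp
      ring
    have hftc := intervalIntegral.integral_eq_sub_of_hasDerivAt (a := 0) (b := 1)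
      (fun x _ => hderiv x) (Continuous.intervalIntegrable (by fun_prop) _ _)
    rw [intervalIntegral.integral_sub (Continuous.intervalIntegrable (by fun_prop) _ _)
      (Continuous.intervalIntegrable (by fun_prop) _ _), intervalIntegral.integral_const_mul,
      intervalIntegral.integral_const_mul, ih] at hftc
    rw [Finset.prod_Icc_succ_top (by omega)]
    have hprod : ∏ l ∈ Finset.Icc 1 t, (1 + 1 / ((l : ℝ) * (r : ℝ))) ≠ 0 :=
      (Finset.prod_pos fun l _ => by positivity).ne'
    simp only [one_pow, sub_self, ne_eq, Nat.add_eq_zero_iff, one_ne_zero, and_false,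
      not_false_eq_true, zero_pow, mul_zero, zero_mul] at hftc
    generalize ∏ l ∈ Finset.Icc 1 t, (1 + 1 / ((l : ℝ) * (r : ℝ))) = p at *
    push_cast
    field_simp at hftc ⊢
    linarith

open Finset in
/-- Some ordering of the coordinates makes at least `n * p₁(r,t)` of them recoverable from
earlier ones. -/
theorem exists_perm_card_ge {n r t : ℕ} (hr : 0 < r) (Γ : Fin n → Fin t → Finset (Fin n))
    (hmem : ∀ j α, j ∈ Γ j α) (hcard : ∀ j α, (Γ j α).card ≤ r + 1)
    (hint : ∀ j α β, α ≠ β → Γ j α ∩ Γ j β = {j}) :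
    ∃ σ : Equiv.Perm (Fin n),
      (n : ℚ) * p1 r t ≤ #{j | ∃ α, ∀ i ∈ (Γ j α).erase j, σ i < σ j} := by
  set I : ℝ := ∫ x in (0 : ℝ)..1, (1 - x ^ r) ^ t with hI
  have hbound : ∀ j, ∑ σ : Equiv.Perm (Fin n),
      ∏ α, (1 - if ∀ i ∈ (Γ j α).erase j, σ i < σ j then (1 : ℝ) else 0) ≤
        n.factorial * I := by
    intro j
    rw [sum_perm_prod_eq_integral j (fun α => (Γ j α).erase j) (fun α => notMem_erase _ _)]
    · gcongr
      refine intervalIntegral.integral_mono_on zero_le_one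
        (Continuous.intervalIntegrable (by fun_prop) _ _)
        (Continuous.intervalIntegrable (by fun_prop) _ _) fun x hx => ?_
      calc ∏ α, (1 - x ^ #((Γ j α).erase j)) ≤ ∏ _α : Fin t, (1 - x ^ r) := by
            refine prod_le_prod (fun α _ => sub_nonneg.2 (pow_le_one₀ hx.1 hx.2)) fun α _ => ?_
            refine sub_le_sub_left (pow_le_pow_of_le_one hx.1 hx.2 ?_) _
            rw [card_erase_of_mem (hmem j α)]
            have := hcard j α
            omega
        _ = (1 - x ^ r) ^ t := by simp
    · intro α β hαβ
      refine disjoint_left.2 fun i h1 h2 => ?_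
      have : i ∈ Γ j α ∩ Γ j β := mem_inter.2 ⟨mem_of_mem_erase h1, mem_of_mem_erase h2⟩
      rw [hint j α β hαβ, mem_singleton] at this
      exact ne_of_mem_erase h1 this
  have hcount : ∀ σ : Equiv.Perm (Fin n),
      ∑ j, ∏ α, (1 - if ∀ i ∈ (Γ j α).erase j, σ i < σ j then (1 : ℝ) else 0) =
        n - #{j | ∃ α, ∀ i ∈ (Γ j α).erase j, σ i < σ j} := by
    intro σ
    have h1 : ∀ j, ∏ α, (1 - if ∀ i ∈ (Γ j α).erase j, σ i < σ j then (1 : ℝ) else 0) =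
        1 - if ∃ α, ∀ i ∈ (Γ j α).erase j, σ i < σ j then (1 : ℝ) else 0 := by
      intro j
      split_ifs with h
      · obtain ⟨α, hα⟩ := h
        rw [sub_self]
        exact prod_eq_zero (mem_univ α) (by rw [if_pos hα, sub_self])
      · rw [sub_zero]
        exact prod_eq_one fun α _ => by rw [if_neg fun hα => h ⟨α, hα⟩, sub_zero]
    simp_rw [h1]
    rw [sum_sub_distrib, sum_boole]
    simp
  have hsum : ∑ σ : Equiv.Perm (Fin n),
      ((n : ℝ) - #{j | ∃ α, ∀ i ∈ (Γ j α).erase j, σ i < σ j}) ≤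
        ∑ _σ : Equiv.Perm (Fin n), n * I := by
    simp_rw [← hcount]
    rw [sum_comm, sum_const, card_univ, Fintype.card_perm, Fintype.card_fin, nsmul_eq_mul]
    refine (sum_le_sum fun j _ => hbound j).trans_eq ?_
    rw [sum_const, card_univ, Fintype.card_fin, nsmul_eq_mul]
    ring
  obtain ⟨σ, -, hσ⟩ := exists_le_of_sum_le univ_nonempty hsum
  refine ⟨σ, ?_⟩
  have hp : ((p1 r t : ℚ) : ℝ) = 1 - I := by
    rw [hI, integral_one_sub_pow_pow r t hr, p1]
    push_cast
    rfl
  rw [← Rat.cast_le (K := ℝ)]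
  push_cast
  rw [hp]
  linarith

open Finset in
theorem card_filter_powersetCard_subset_mul_choose {ι : Type*} [DecidableEq ι]
    (s U : Finset ι) (N : ℕ) (hs : s ⊆ U) :
    #{S ∈ powersetCard N U | s ⊆ S} * (#U).choose #s = (#U).choose N * N.choose #s := by
  rcases le_or_gt #s N with h | h
  · rw [card_filter_powersetCard_subset s U N hs h, Nat.choose_mul h, mul_comm]
  · rw [Nat.choose_eq_zero_of_lt h, mul_zero, mul_eq_zero, card_eq_zero, filter_eq_empty_iff]
    refine Or.inl fun S hS hsS => ?_
    have := card_le_card hsS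
    rw [(mem_powersetCard.1 hS).2] at this
    omega

open Finset in
/-- Averaging over all `N`-element subfamilies of `R` bounds the smallest union of such a
subfamily. -/
theorem exists_powersetCard_card_biUnion_le {ι κ : Type*} [DecidableEq ι] [DecidableEq κ]
    [Fintype κ] (U : Finset ι) (R : ι → Finset κ) (r N : ℕ) (hR : ∀ i ∈ U, #(R i) ≤ r + 1)
    (hU : 2 ≤ #U) (hN : N ≤ #U) :
    ∃ S ∈ powersetCard N U, (#(S.biUnion R) : ℚ) ≤ (N : ℚ) * ((r : ℚ) + 1) -
      ((N : ℚ) * ((N : ℚ) - 1)) / ((#U : ℚ) * ((#U : ℚ) - 1)) *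
        ((#U : ℚ) * ((r : ℚ) + 1) - (Fintype.card κ : ℚ)) := by
  set M := #U with hM
  set w : ℚ := ((N : ℚ) * ((N : ℚ) - 1)) / ((M : ℚ) * ((M : ℚ) - 1)) with hw
  set P := powersetCard N U with hP
  have hM2 : (2 : ℚ) ≤ M := by exact_mod_cast hU
  have hM1 : (0 : ℚ) < M - 1 := by linarith
  have hNM : (N : ℚ) ≤ M := by exact_mod_cast hN
  have hPcard : (#P : ℚ) = M.choose N := by rw [hP, card_powersetCard]
  have hw0 : 0 ≤ w := by
    refine div_nonneg ?_ (by positivity)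
    rcases Nat.eq_zero_or_pos N with h | h
    · simp [h]
    · have : (1 : ℚ) ≤ N := by exact_mod_cast h
      exact mul_nonneg (by linarith) (by linarith)
  have hwN : w ≤ N / M := by
    rw [hw, div_le_div_iff₀ (by positivity) (by positivity)]
    have : (0 : ℚ) ≤ N * M * (M - N) := by
      exact mul_nonneg (by positivity) (by linarith)
    linarith
  have hone : ∀ i ∈ U, (#{S ∈ P | i ∈ S} : ℚ) = #P * (N / M) := by
    intro i hi
    have h := card_filter_powersetCard_subset_mul_choose {i} U N (by simpa using hi)
    simp only [singleton_subset_iff, card_singleton, Nat.choose_one_right] at h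
    rw [hPcard]
    field_simp
    exact_mod_cast h
  have htwo : ∀ i ∈ U, ∀ k ∈ U, i ≠ k → (#{S ∈ P | i ∈ S ∧ k ∈ S} : ℚ) = #P * w := by
    intro i hi k hk hik
    have h := card_filter_powersetCard_subset_mul_choose {i, k} U N
      (by simp [insert_subset_iff, hi, hk])
    simp only [insert_subset_iff, singleton_subset_iff, card_pair hik] at h
    have h' := congrArg (Nat.cast : ℕ → ℚ) h
    push_cast [Nat.cast_choose_two] at h'
    rw [hPcard, hw]
    field_simp
    linarith
  set a : κ → ℕ := fun j => #{i ∈ U | j ∈ R i} with ha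
  have hpoint : ∀ j, (#{S ∈ P | j ∈ S.biUnion R} : ℚ) ≤ #P * (a j * (N / M - w) + w) := by
    intro j
    rcases ({i ∈ U | j ∈ R i} : Finset ι).eq_empty_or_nonempty with h | ⟨k, hk⟩
    · have h0 : ({S ∈ P | j ∈ S.biUnion R} : Finset (Finset ι)) = ∅ := by
        rw [filter_eq_empty_iff] at h ⊢
        intro S hS hj
        obtain ⟨i, hi, hji⟩ := mem_biUnion.1 hj
        exact h ((mem_powersetCard.1 hS).1 hi) hji
      simp only [ha, h, h0, card_empty, Nat.cast_zero, zero_mul, zero_add]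
      positivity
    · set V := ({i ∈ U | j ∈ R i} : Finset ι).erase k with hV
      have hkU : k ∈ U := (mem_filter.1 hk).1
      have hVU : ∀ i ∈ V, i ∈ U ∧ i ≠ k := fun i hi =>
        ⟨(mem_filter.1 (mem_of_mem_erase hi)).1, ne_of_mem_erase hi⟩
      have haV : (a j : ℚ) = #V + 1 := by
        have := card_erase_add_one hk
        simp only [ha]
        rw [← this]
        push_cast
        rfl
      have hS : ∀ S ∈ P, (if j ∈ S.biUnion R then (1 : ℚ) else 0) ≤ (if k ∈ S then 1 else 0) +
          ∑ i ∈ V, ((if i ∈ S then 1 else 0) - if i ∈ S ∧ k ∈ S then 1 else 0) := by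
        intro S hSP
        by_cases hkS : k ∈ S
        · simp only [hkS, and_true, sub_self, sum_const_zero, if_true, add_zero]
          split_ifs <;> norm_num
        · simp only [hkS, and_false, if_false, sub_zero, zero_add]
          split_ifs with hj
          · obtain ⟨i, hi, hji⟩ := mem_biUnion.1 hj
            have hiV : i ∈ V := mem_erase.2 ⟨fun h => hkS (h ▸ hi),
              mem_filter.2 ⟨(mem_powersetCard.1 hSP).1 hi, hji⟩⟩
            calc (1 : ℚ) = if i ∈ S then 1 else 0 := by rw [if_pos hi]
              _ ≤ _ := single_le_sum (f := fun i => if i ∈ S then (1 : ℚ) else 0)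
                (fun i _ => by positivity) hiV
          · exact sum_nonneg fun i _ => by positivity
      have h := sum_le_sum hS
      rw [sum_boole, sum_add_distrib, sum_boole, sum_comm, hone k hkU] at h
      simp only [sum_sub_distrib, sum_boole] at h
      rw [sum_congr rfl fun i hi => hone i (hVU i hi).1,
        sum_congr rfl fun i hi => htwo i (hVU i hi).1 k hkU (hVU i hi).2] at h
      simp only [sum_const, nsmul_eq_mul] at h
      rw [haV]
      linarith
  have hasum : (∑ j, (a j : ℚ)) ≤ M * (r + 1) := by
    have h : ∑ j, a j = ∑ i ∈ U, #(R i) := by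
      simp only [ha, card_filter]
      rw [sum_comm]
      simp
    have h2 : ∑ i ∈ U, #(R i) ≤ M * (r + 1) := by
      simpa using sum_le_card_nsmul U _ _ hR
    rw [← h] at h2
    exact_mod_cast h2
  have hsum : ∑ S ∈ P, (#(S.biUnion R) : ℚ) = ∑ j, (#{S ∈ P | j ∈ S.biUnion R} : ℚ) := by
    simp_rw [← sum_boole]
    rw [sum_comm]
    refine sum_congr rfl fun S _ => ?_
    rw [sum_boole]
    congr 2
    ext j
    simp
  refine exists_le_of_sum_le (powersetCard_nonempty.2 hN) ?_
  rw [hsum, sum_const, nsmul_eq_mul]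
  refine (sum_le_sum fun j _ => hpoint j).trans ?_
  rw [← mul_sum, sum_add_distrib, ← sum_mul, sum_const, card_univ, nsmul_eq_mul]
  refine mul_le_mul_of_nonneg_left ?_ (Nat.cast_nonneg _)
  calc (∑ j, (a j : ℚ)) * (N / M - w) + Fintype.card κ * w
      ≤ M * (r + 1) * (N / M - w) + Fintype.card κ * w := by
        gcongr
    _ = _ := by
        field_simp
        ring

theorem N1_spec {n r d M : ℕ} (hdn : d - 1 ≤ n) (hd : 0 < d) :
    N1 n r d M ≤ M ∧
      (N1 n r d M : ℚ) * ((r : ℚ) + 1) -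
        ((N1 n r d M : ℚ) * ((N1 n r d M : ℚ) - 1)) / ((M : ℚ) * ((M : ℚ) - 1)) *
          ((M : ℚ) * ((r : ℚ) + 1) - (n : ℚ)) ≤ ((n - (d - 1) : ℕ) : ℚ) := by
  have hcast : ((n - (d - 1) : ℕ) : ℚ) = (n : ℚ) - ((d : ℚ) - 1) := by
    rw [Nat.cast_sub hdn, Nat.cast_sub hd, Nat.cast_one]
  have hne : ((Finset.range (M + 1)).filter (fun N : ℕ =>
      (N : ℚ) * ((r : ℚ) + 1) - ((N : ℚ) * ((N : ℚ) - 1)) / ((M : ℚ) * ((M : ℚ) - 1)) *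
        ((M : ℚ) * ((r : ℚ) + 1) - (n : ℚ)) ≤ (n : ℚ) - ((d : ℚ) - 1))).Nonempty := by
    refine ⟨0, Finset.mem_filter.2 ⟨by simp, ?_⟩⟩
    rw [← hcast]
    simp
  obtain ⟨N, hN, hNeq⟩ := Finset.exists_mem_eq_sup _ hne id
  have hN1 : N1 n r d M = N := hNeq
  rw [hN1, hcast]
  rw [Finset.mem_filter, Finset.mem_range] at hN
  exact ⟨by omega, hN.2⟩

open Finset in
/-- If each coordinate in `S` is determined by coordinates of `T` that come earlier in the
order `σ`, then codewords agreeing on `T \ S` agree on `T`. -/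
theorem eqOn_of_eqOn_sdiff {n : ℕ} {α : Type*} (σ : Equiv.Perm (Fin n))
    (S T : Finset (Fin n)) (R : Fin n → Finset (Fin n)) (c₁ c₂ : Fin n → α)
    (hRT : ∀ j ∈ S, R j ⊆ T) (hσ : ∀ j ∈ S, ∀ i ∈ R j, i ≠ j → σ i < σ j)
    (hrec : ∀ j ∈ S, c₁ j ≠ c₂ j → ∃ i ∈ R j, i ≠ j ∧ c₁ i ≠ c₂ i)
    (heq : ∀ i ∈ T \ S, c₁ i = c₂ i) : ∀ i ∈ T, c₁ i = c₂ i := by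
  by_contra! h
  obtain ⟨i, hiT, hi⟩ := h
  have : DecidableEq α := Classical.decEq α
  obtain ⟨j, hj, hmin⟩ := exists_min_image {i ∈ T | c₁ i ≠ c₂ i} σ
    ⟨i, mem_filter.2 ⟨hiT, hi⟩⟩
  obtain ⟨hjT, hjne⟩ := mem_filter.1 hj
  have hjS : j ∈ S := by
    by_contra hjS
    exact hjne (heq j (mem_sdiff.2 ⟨hjT, hjS⟩))
  obtain ⟨k, hk, hkj, hkne⟩ := hrec j hjS hjne
  exact (hmin k (mem_filter.2 ⟨hRT j hjS hk, hkne⟩)).not_gt (hσ j hjS k hk hkj)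

open Finset in
theorem eq_of_eqOn_of_lt_hammingDist {n d : ℕ} {α : Type*} [DecidableEq α]
    {c₁ c₂ : Fin n → α} (T : Finset (Fin n)) (hT : n < #T + d)
    (heq : ∀ i ∈ T, c₁ i = c₂ i) (hdist : c₁ ≠ c₂ → d ≤ hammingDist c₁ c₂) : c₁ = c₂ := by
  by_contra hne
  have h1 := hdist hne
  have h2 : hammingDist c₁ c₂ ≤ #Tᶜ := by
    refine card_le_card fun i hi => ?_
    rw [mem_compl]
    exact fun hiT => (mem_filter.1 hi).2 (heq i hiT)
  rw [card_compl, Fintype.card_fin] at h2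
  have := card_le_univ T
  rw [Fintype.card_fin] at this
  omega

open Finset in
theorem card_le_pow_of_injOn_restrict {n q : ℕ} (C : Finset (Fin n → Fin q))
    (W : Finset (Fin n))
    (hinj : ∀ c₁ ∈ C, ∀ c₂ ∈ C, (∀ i ∈ W, c₁ i = c₂ i) → c₁ = c₂) : #C ≤ q ^ #W := by
  calc #C ≤ #(univ : Finset (W → Fin q)) := by
        refine card_le_card_of_injOn (fun c i => c i) (fun _ _ => mem_coe.2 (mem_univ _)) ?_
        intro c₁ h₁ c₂ h₂ h
        exact hinj c₁ h₁ c₂ h₂ fun i hi => congrFun h ⟨i, hi⟩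
    _ = q ^ #W := by simp

theorem classical_LRC_bound (n d r t q : ℕ)
    (hn : 0 < n) (hd : 0 < d) (hr : 0 < r) (ht : 0 < t) (hq : 2 ≤ q)
    (hmax : max (r + 1) (d - 1) ≤ n)
    (M₀ : ℕ) (hM₀ : M₀ = (⌈(n : ℚ) * p1 r t⌉).toNat) (hM₀2 : 2 ≤ M₀)
    (C : Finset (Fin n → Fin q))
    (hdist : ∀ c₁ ∈ C, ∀ c₂ ∈ C, c₁ ≠ c₂ → d ≤ hammingDist c₁ c₂)
    (Γ : Fin n → Fin t → Finset (Fin n))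
    (hmem : ∀ j α, j ∈ Γ j α)
    (hcard : ∀ j α, (Γ j α).card ≤ r + 1)
    (hint : ∀ j α β, α ≠ β → Γ j α ∩ Γ j β = {j})
    (hrec : ∀ (j : Fin n) (α : Fin t), ∀ c₁ ∈ C, ∀ c₂ ∈ C, c₁ j ≠ c₂ j →
      ∃ i ∈ Γ j α, i ≠ j ∧ c₁ i ≠ c₂ i) :
    (d - 1) + N1 n r d M₀ ≤ n ∧ C.card ≤ q ^ (n - (d - 1) - N1 n r d M₀) := by
  obtain ⟨σ, hσ⟩ := exists_perm_card_ge hr Γ hmem hcard hint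
  obtain ⟨U, hU, hUcard⟩ := Finset.exists_subset_card_eq (n := M₀) (by
    rw [hM₀, Int.toNat_le, Int.ceil_le]
    exact_mod_cast hσ)
  have hex : ∀ j, ∃ α : Fin t, j ∈ U → ∀ i ∈ (Γ j α).erase j, σ i < σ j := by
    intro j
    by_cases hj : j ∈ U
    · obtain ⟨α, hα⟩ := (Finset.mem_filter.1 (hU hj)).2
      exact ⟨α, fun _ => hα⟩
    · exact ⟨⟨0, ht⟩, fun h => absurd h hj⟩
  choose α hα using hex
  have hdn : d - 1 ≤ n := le_trans (le_max_right _ _) hmax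
  obtain ⟨hNM, hN⟩ := N1_spec (M := M₀) (r := r) hdn hd
  obtain ⟨S, hS, hSR⟩ := exists_powersetCard_card_biUnion_le U (fun j => Γ j (α j)) r
    (N1 n r d M₀) (fun j _ => hcard j _) (by omega) (by omega)
  obtain ⟨hSU, hScard⟩ := Finset.mem_powersetCard.1 hS
  rw [hUcard, Fintype.card_fin] at hSR
  have hunion : (S.biUnion fun j => Γ j (α j)).card ≤ n - (d - 1) := by
    exact_mod_cast hSR.trans hN
  obtain ⟨T, hRT, hTcard⟩ := Finset.exists_superset_card_eq hunion (by simp)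
  have hST : S ⊆ T := fun j hj => hRT (Finset.mem_biUnion.2 ⟨j, hj, hmem j _⟩)
  have hle := Finset.card_le_card hST
  refine ⟨by omega, ?_⟩
  rw [← hTcard, ← hScard, ← Finset.card_sdiff_of_subset hST]
  refine card_le_pow_of_injOn_restrict C _ fun c₁ h₁ c₂ h₂ heq => ?_
  refine eq_of_eqOn_of_lt_hammingDist T (by omega) ?_ (hdist c₁ h₁ c₂ h₂)
  refine eqOn_of_eqOn_sdiff σ S T (fun j => Γ j (α j)) c₁ c₂ ?_ ?_ ?_ heq
  · exact fun j hj => (Finset.subset_biUnion_of_mem (fun j => Γ j (α j)) hj).trans hRT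
  · exact fun j hj i hi hij => hα j (hSU hj) i (Finset.mem_erase.2 ⟨hij, hi⟩)
  · exact fun j _ => hrec j (α j) c₁ h₁ c₂ h₂
end

section
/- Suppose G₁ = (V₁, W₁, E₁) and its transpose G₁ᵀ are both (r₁, r₁+1, 1)-exact bipartite graphs, and G₂ = (V₂, W₂, E₂) and its transpose G₂ᵀ are both (r₂, r₂+1, 1)-exact bipartite graphs. Then the product G₁ ⊠ G₂ and its transpose are both (r₁+r₂+1, r₁+r₂+2, 1)-exact bipartite graphs. -/
/-- A bipartite graph, given by its adjacency relation `Adj : V → W → Prop`,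
is `(r,t,s)`-exact if every vertex of `V` has exactly `t` neighbors in `W`,
every vertex of `W` has exactly `r+1` neighbors in `V`, any two distinct
vertices of `W` have either no common neighbor or exactly `s+1` common
neighbors, and any three pairwise distinct vertices of `W` have either no
common neighbor or exactly one common neighbor. -/
def IsExactBipartite (r t s : ℕ) {V W : Type*} (Adj : V → W → Prop) : Prop :=
  (∀ v : V, Nat.card {w : W // Adj v w} = t) ∧
  (∀ w : W, Nat.card {v : V // Adj v w} = r + 1) ∧
  (∀ w w' : W, w ≠ w' →
    Nat.card {v : V // Adj v w ∧ Adj v w'} = 0 ∨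
    Nat.card {v : V // Adj v w ∧ Adj v w'} = s + 1) ∧
  (∀ w w' w'' : W, w ≠ w' → w ≠ w'' → w' ≠ w'' →
    Nat.card {v : V // Adj v w ∧ Adj v w' ∧ Adj v w''} = 0 ∨
    Nat.card {v : V // Adj v w ∧ Adj v w' ∧ Adj v w''} = 1)

/-- The adjacency relation of the product `G₁ ⊠ G₂` of two bipartite graphs:
bit side `(V₁×V₂) ⊔ (W₁×W₂)`, check side `(W₁×V₂) ⊔ (V₁×W₂)`;
`(x₁,x₂)` is adjacent to `(y₁,y₂)` iff either `x₁ = y₁` and `{x₂,y₂}` is an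
edge of `G₂`, or `x₂ = y₂` and `{x₁,y₁}` is an edge of `G₁`. -/
def prodAdj {V₁ W₁ V₂ W₂ : Type*} (Adj₁ : V₁ → W₁ → Prop) (Adj₂ : V₂ → W₂ → Prop) :
    (V₁ × V₂ ⊕ W₁ × W₂) → (W₁ × V₂ ⊕ V₁ × W₂) → Prop
  | Sum.inl (v₁, v₂), Sum.inl (w₁, v₂') => v₂ = v₂' ∧ Adj₁ v₁ w₁
  | Sum.inl (v₁, v₂), Sum.inr (v₁', w₂) => v₁ = v₁' ∧ Adj₂ v₂ w₂
  | Sum.inr (w₁, w₂), Sum.inl (w₁', v₂) => w₁ = w₁' ∧ Adj₂ v₂ w₂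
  | Sum.inr (w₁, w₂), Sum.inr (v₁, w₂') => w₂ = w₂' ∧ Adj₁ v₁ w₁

theorem card_subtype_sum {α β : Type*} [Finite α] [Finite β] (P : α ⊕ β → Prop) :
    Nat.card {x // P x} =
      Nat.card {a // P (Sum.inl a)} + Nat.card {b // P (Sum.inr b)} := by
  rw [Nat.card_congr (Equiv.subtypeSum (p := P)), Nat.card_sum]

theorem card_subtype_prod_fst_eq {α β : Type*} (a : α) (P : β → Prop) :
    Nat.card {p : α × β // a = p.1 ∧ P p.2} = Nat.card {b // P b} :=
  Nat.card_congr
    { toFun := fun p => ⟨p.1.2, p.2.2⟩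
      invFun := fun b => ⟨(a, b.1), rfl, b.2⟩
      left_inv := by rintro ⟨⟨x, y⟩, h, _⟩; cases h; rfl
      right_inv := fun _ => rfl }

theorem card_subtype_prod_snd_eq {α β : Type*} (b : β) (P : α → Prop) :
    Nat.card {p : α × β // b = p.2 ∧ P p.1} = Nat.card {a // P a} :=
  Nat.card_congr
    { toFun := fun p => ⟨p.1.1, p.2.2⟩
      invFun := fun a => ⟨(a.1, b), rfl, a.2⟩
      left_inv := by rintro ⟨⟨x, y⟩, h, _⟩; cases h; rfl
      right_inv := fun _ => rfl }

theorem card_subtype_eq_zero_or_two_iff {α : Type*} [Finite α] (P : α → Prop) :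
    (Nat.card {x // P x} = 0 ∨ Nat.card {x // P x} = 1 + 1) ↔
      ∀ x, P x → ∃ y, y ≠ x ∧ P y ∧ ∀ z, P z → z = x ∨ z = y := by
  constructor
  · rintro (h | h) x hx
    · exact ((Finite.card_eq_zero_iff.1 h).false ⟨x, hx⟩).elim
    · obtain ⟨y, hy, hu⟩ := (Nat.card_eq_two_iff' (⟨x, hx⟩ : {x // P x})).1 h
      refine ⟨y, fun e => hy (Subtype.ext e), y.2, fun z hz => ?_⟩
      by_cases hzx : z = x
      · exact Or.inl hzx
      · exact Or.inr (congrArg Subtype.val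
          (hu ⟨z, hz⟩ fun e => hzx (congrArg Subtype.val e)))
  · intro h
    rcases isEmpty_or_nonempty {x // P x} with _ | ⟨⟨x, hx⟩⟩
    · exact Or.inl Nat.card_of_isEmpty
    · obtain ⟨y, hne, hy, hu⟩ := h x hx
      refine Or.inr ((Nat.card_eq_two_iff' (⟨x, hx⟩ : {x // P x})).2
        ⟨⟨y, hy⟩, fun e => hne (congrArg Subtype.val e), fun z hz => Subtype.ext ?_⟩)
      exact (hu z z.2).resolve_left fun e => hz (Subtype.ext e)

theorem card_subtype_eq_zero_or_one_iff {α : Type*} [Finite α] (P : α → Prop) :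
    (Nat.card {x // P x} = 0 ∨ Nat.card {x // P x} = 1) ↔
      ∀ x y, P x → P y → x = y := by
  rw [← Nat.le_one_iff_eq_zero_or_eq_one, Finite.card_le_one_iff_subsingleton]
  exact ⟨fun _ x y hx hy =>
      congrArg Subtype.val (Subsingleton.elim (⟨x, hx⟩ : {x // P x}) ⟨y, hy⟩),
    fun h => ⟨fun x y => Subtype.ext (h x y x.2 y.2)⟩⟩

theorem isExactBipartite_one_iff {V W : Type*} [Finite V] (r t : ℕ) (Adj : V → W → Prop) :
    IsExactBipartite r t 1 Adj ↔
      (∀ v, Nat.card {w // Adj v w} = t) ∧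
      (∀ w, Nat.card {v // Adj v w} = r + 1) ∧
      (∀ w w', w ≠ w' → ∀ x, Adj x w ∧ Adj x w' →
        ∃ y, y ≠ x ∧ (Adj y w ∧ Adj y w') ∧ ∀ z, Adj z w ∧ Adj z w' → z = x ∨ z = y) ∧
      (∀ w w' w'', w ≠ w' → w ≠ w'' → w' ≠ w'' →
        ∀ x y, Adj x w ∧ Adj x w' ∧ Adj x w'' → Adj y w ∧ Adj y w' ∧ Adj y w'' → x = y) := by
  simp only [IsExactBipartite, card_subtype_eq_zero_or_two_iff, card_subtype_eq_zero_or_one_iff]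

theorem IsExactBipartite.congr {V W V' W' : Type*} {r t s : ℕ} {Adj : V → W → Prop}
    (h : IsExactBipartite r t s Adj) (e : V' ≃ V) (f : W' ≃ W) :
    IsExactBipartite r t s (fun v w => Adj (e v) (f w)) := by
  obtain ⟨ha, hb, hc, hd⟩ := h
  refine ⟨fun v => ?_, fun w => ?_, fun w w' h => ?_, fun w w' w'' h h' h'' => ?_⟩
  · rw [← ha (e v)]
    exact Nat.card_congr (f.subtypeEquiv fun _ => Iff.rfl)
  · rw [← hb (f w)]
    exact Nat.card_congr (e.subtypeEquiv fun _ => Iff.rfl)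
  · rw [Nat.card_congr (e.subtypeEquiv
      (q := fun v => Adj v (f w) ∧ Adj v (f w')) fun _ => Iff.rfl)]
    exact hc _ _ (f.injective.ne h)
  · rw [Nat.card_congr (e.subtypeEquiv
      (q := fun v => Adj v (f w) ∧ Adj v (f w') ∧ Adj v (f w'')) fun _ => Iff.rfl)]
    exact hd _ _ _ (f.injective.ne h) (f.injective.ne h') (f.injective.ne h'')

theorem isExactBipartite_prodAdj {V₁ W₁ V₂ W₂ : Type*}
    [Finite V₁] [Finite W₁] [Finite V₂] [Finite W₂]
    {r₁ r₂ : ℕ} {Adj₁ : V₁ → W₁ → Prop} {Adj₂ : V₂ → W₂ → Prop}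
    (h₁ : IsExactBipartite r₁ (r₁ + 1) 1 Adj₁)
    (h₁T : IsExactBipartite r₁ (r₁ + 1) 1 (fun w v => Adj₁ v w))
    (h₂ : IsExactBipartite r₂ (r₂ + 1) 1 Adj₂)
    (h₂T : IsExactBipartite r₂ (r₂ + 1) 1 (fun w v => Adj₂ v w)) :
    IsExactBipartite (r₁ + r₂ + 1) (r₁ + r₂ + 2) 1 (prodAdj Adj₁ Adj₂) := by
  rw [isExactBipartite_one_iff] at *
  obtain ⟨a₁, b₁, c₁, d₁⟩ := h₁
  obtain ⟨a₂, b₂, c₂, d₂⟩ := h₂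
  obtain ⟨-, -, c₁T, d₁T⟩ := h₁T
  obtain ⟨-, -, c₂T, d₂T⟩ := h₂T
  refine ⟨?_, ?_, ?_, ?_⟩
  · rintro (⟨x, y⟩ | ⟨x, y⟩) <;> rw [card_subtype_sum]
    · have e₁ := card_subtype_prod_snd_eq y (Adj₁ x)
      have e₂ := card_subtype_prod_fst_eq x (Adj₂ y)
      simp only [prodAdj]
      rw [e₁, e₂, a₁, a₂]
      ring
    · have e₁ := card_subtype_prod_fst_eq x (fun v => Adj₂ v y)
      have e₂ := card_subtype_prod_snd_eq y (fun v => Adj₁ v x)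
      simp only [prodAdj]
      rw [e₁, e₂, b₁, b₂]
      ring
  · rintro (⟨x, y⟩ | ⟨x, y⟩) <;> rw [card_subtype_sum] <;>
      simp only [prodAdj, @eq_comm _ _ x, @eq_comm _ _ y]
    · have e₁ := card_subtype_prod_snd_eq y (fun v => Adj₁ v x)
      have e₂ := card_subtype_prod_fst_eq x (Adj₂ y)
      rw [e₁, e₂, b₁, a₂]
      ring
    · have e₁ := card_subtype_prod_fst_eq x (fun v => Adj₂ v y)
      have e₂ := card_subtype_prod_snd_eq y (Adj₁ x)
      rw [e₁, e₂, b₂, a₁]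
      ring
  · clear a₁ a₂ b₁ b₂ d₁ d₂ d₁T d₂T
    rintro (⟨p, q⟩ | ⟨p, q⟩) (⟨p', q'⟩ | ⟨p', q'⟩) hne (⟨x, y⟩ | ⟨x, y⟩) <;>
      simp only [prodAdj, Sum.forall, Prod.forall] <;> intro h
    · obtain ⟨z, hz⟩ := c₁ p p' (by grind) x (by grind)
      clear c₁ c₂ c₁T c₂T
      exact ⟨.inl (z, y), by grind⟩
    · obtain ⟨z, hz⟩ := c₂T q q' (by grind) y (by grind)
      clear c₁ c₂ c₁T c₂T
      exact ⟨.inr (x, z), by grind⟩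
    · exact ⟨Sum.inr (p, q'), by grind⟩
    · exact ⟨Sum.inl (p', q), by grind⟩
    · exact ⟨Sum.inr (p', q), by grind⟩
    · exact ⟨Sum.inl (p, q'), by grind⟩
    · obtain ⟨z, hz⟩ := c₂ q q' (by grind) y (by grind)
      clear c₁ c₂ c₁T c₂T
      exact ⟨.inl (x, z), by grind⟩
    · obtain ⟨z, hz⟩ := c₁T p p' (by grind) x (by grind)
      clear c₁ c₂ c₁T c₂T
      exact ⟨.inr (z, y), by grind⟩
  · clear a₁ a₂ b₁ b₂ c₁ c₂ c₁T c₂T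
    rintro (⟨p, q⟩ | ⟨p, q⟩) (⟨p', q'⟩ | ⟨p', q'⟩) (⟨p'', q''⟩ | ⟨p'', q''⟩) h h' h''
      (⟨x, y⟩ | ⟨x, y⟩) (⟨x', y'⟩ | ⟨x', y'⟩) <;>
      revert h h' h'' <;>
      simp only [prodAdj, ne_eq, Sum.inl.injEq, Sum.inr.injEq, Prod.mk.injEq, reduceCtorEq,
        not_false_eq_true, forall_const] <;>
      grind

theorem prod_of_exact_is_exact {V₁ W₁ V₂ W₂ : Type*}
    [Fintype V₁] [Fintype W₁] [Fintype V₂] [Fintype W₂]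
    (r₁ r₂ : ℕ) (Adj₁ : V₁ → W₁ → Prop) (Adj₂ : V₂ → W₂ → Prop)
    (h₁ : IsExactBipartite r₁ (r₁ + 1) 1 Adj₁)
    (h₁T : IsExactBipartite r₁ (r₁ + 1) 1 (fun w v => Adj₁ v w))
    (h₂ : IsExactBipartite r₂ (r₂ + 1) 1 Adj₂)
    (h₂T : IsExactBipartite r₂ (r₂ + 1) 1 (fun w v => Adj₂ v w)) :
    IsExactBipartite (r₁ + r₂ + 1) (r₁ + r₂ + 2) 1 (prodAdj Adj₁ Adj₂) ∧
    IsExactBipartite (r₁ + r₂ + 1) (r₁ + r₂ + 2) 1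
      (fun w v => prodAdj Adj₁ Adj₂ v w) := by
  refine ⟨isExactBipartite_prodAdj h₁ h₁T h₂ h₂T, ?_⟩
  have h := (isExactBipartite_prodAdj h₁ h₁T h₂T h₂).congr (Equiv.sumComm _ _) (Equiv.sumComm _ _)
  convert h using 3 with w v
  rcases w with ⟨w, v'⟩ | ⟨v', w⟩ <;> rcases v with ⟨a, b⟩ | ⟨a, b⟩ <;>
    simp [prodAdj, eq_comm]
end

section
/- Let F be a field and H a matrix over F with rows indexed by a finite set W and columns indexed by [n], such that: every column of H has exactly t nonzero entries; every row has exactly r+1 nonzero entries; the supports of any two distinct rows intersect in either 0 or exactly s+1 positions; and the supports of any three pairwise distinct rows intersect in either 0 or exactly 1 position. For each j ∈ [n], let Γ₁(j),…,Γ_t(j) ⊆ [n] be the supports of the t rows of H whose j-th entry is nonzero. Then the family (Γ_l(j))_{1≤l≤t, 1≤j≤n} satisfies the exact (r,t,s)-condition, and for every subset C₁ of the kernel of H (vectors c ∈ Fⁿ with Hc = 0), every j ∈ [n], every l ∈ [t], and all c₁, c₂ ∈ C₁ with c₁(j) ≠ c₂(j), the restrictions of c₁ and c₂ to Γ_l(j)∖{j}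 differ. -/
theorem exact_tanner_gives_exact_LRC {F : Type*} [Field F] [DecidableEq F]
    {W : Type*} [Fintype W] (n r t s : ℕ)
    (H : Matrix W (Fin n) F)
    (hcol : ∀ j : Fin n, (Finset.univ.filter (fun w : W => H w j ≠ 0)).card = t)
    (hrow : ∀ w : W, (Finset.univ.filter (fun j : Fin n => H w j ≠ 0)).card = r + 1)
    (hpair : ∀ w w' : W, w ≠ w' →
      (Finset.univ.filter (fun j : Fin n => H w j ≠ 0 ∧ H w' j ≠ 0)).card = 0 ∨
      (Finset.univ.filter (fun j : Fin n => H w j ≠ 0 ∧ H w' j ≠ 0)).card = s + 1)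
    (htriple : ∀ w w' w'' : W, w ≠ w' → w ≠ w'' → w' ≠ w'' →
      (Finset.univ.filter
        (fun j : Fin n => H w j ≠ 0 ∧ H w' j ≠ 0 ∧ H w'' j ≠ 0)).card = 0 ∨
      (Finset.univ.filter
        (fun j : Fin n => H w j ≠ 0 ∧ H w' j ≠ 0 ∧ H w'' j ≠ 0)).card = 1) :
    -- the family of supports of rows nonzero at `j` satisfies the exact
    -- `(r,t,s)`-condition:
    ((∀ (j : Fin n) (w : W), H w j ≠ 0 →
        (Finset.univ.filter (fun i : Fin n => H w i ≠ 0)).card = r + 1 ∧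
        j ∈ Finset.univ.filter (fun i : Fin n => H w i ≠ 0)) ∧
      (∀ (j : Fin n) (w w' : W), w ≠ w' → H w j ≠ 0 → H w' j ≠ 0 →
        ((Finset.univ.filter (fun i : Fin n => H w i ≠ 0)) ∩
          (Finset.univ.filter (fun i : Fin n => H w' i ≠ 0))).card = s + 1) ∧
      (∀ (j : Fin n) (w w' w'' : W), w ≠ w' → w ≠ w'' → w' ≠ w'' →
        H w j ≠ 0 → H w' j ≠ 0 → H w'' j ≠ 0 →
        (Finset.univ.filter (fun i : Fin n => H w i ≠ 0)) ∩
          (Finset.univ.filter (fun i : Fin n => H w' i ≠ 0)) ∩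
          (Finset.univ.filter (fun i : Fin n => H w'' i ≠ 0)) = {j})) ∧
    -- and local recoverability holds for any subcode of the kernel of `H`:
    (∀ C₁ : Set (Fin n → F), (∀ c ∈ C₁, H.mulVec c = 0) →
      ∀ c₁ ∈ C₁, ∀ c₂ ∈ C₁, ∀ (j : Fin n) (w : W), H w j ≠ 0 →
        c₁ j ≠ c₂ j → ∃ i : Fin n, H w i ≠ 0 ∧ i ≠ j ∧ c₁ i ≠ c₂ i) := by
  refine ⟨⟨fun j w hw => ⟨hrow w, by simpa using hw⟩, fun j w w' hne hw hw' => ?_,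
    fun j w w' w'' h₁ h₂ h₃ hw hw' hw'' => ?_⟩, ?_⟩
  · rw [← Finset.filter_and]
    refine (hpair w w' hne).resolve_left fun h => ?_
    have hj : j ∈ Finset.univ.filter (fun i : Fin n => H w i ≠ 0 ∧ H w' i ≠ 0) := by
      simp [hw, hw']
    rw [Finset.card_eq_zero.mp h] at hj
    exact Finset.notMem_empty j hj
  · have hj : j ∈ Finset.univ.filter
        (fun i : Fin n => H w i ≠ 0 ∧ H w' i ≠ 0 ∧ H w'' i ≠ 0) := by
      simp [hw, hw', hw'']
    rw [← Finset.filter_and, ← Finset.filter_and]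
    simp only [and_assoc]
    rcases htriple w w' w'' h₁ h₂ h₃ with h | h
    · rw [Finset.card_eq_zero.mp h] at hj
      exact absurd hj (Finset.notMem_empty j)
    · obtain ⟨a, ha⟩ := Finset.card_eq_one.mp h
      rw [ha] at hj ⊢
      rw [Finset.mem_singleton.mp hj]
  · intro C₁ hC c₁ hc₁ c₂ hc₂ j w hw hne
    by_contra! hcon
    have hker : H.mulVec (c₁ - c₂) w = 0 := by
      rw [Matrix.mulVec_sub, hC c₁ hc₁, hC c₂ hc₂]
      simp
    have hsum : ∑ i, H w i * (c₁ - c₂) i = H w j * (c₁ - c₂) j := by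
      refine Finset.sum_eq_single j (fun i _ hij => ?_) (by simp)
      by_cases hi : H w i = 0
      · simp [hi]
      · simp [hcon i hi hij]
    have hzero : H w j * (c₁ - c₂) j = 0 := hsum.symm.trans hker
    exact (mul_ne_zero hw (sub_ne_zero.mpr hne)) hzero
end

section
/- Let n, r, M, N be integers with M ≥ 2 and 0 ≤ N ≤ M, and let A₁,…,A_M be subsets of [n] with |A_m| = r+1 for every 1 ≤ m ≤ M. Then there exists a subset S ⊆ [M] with |S| = N such that |⋃_{m∈S} A_m| ≤ N(r+1) − [N(N−1)/(M(M−1))]·(M(r+1)−n), as an inequality of rational numbers. -/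
/-- Every point of a union is either covered twice or lost when some member is removed;
summing this over all points bounds the total size of the unions with one member removed. -/
theorem Finset.sum_card_biUnion_erase_add_le {ι α : Type*} [DecidableEq ι] [DecidableEq α]
    (S : Finset ι) (A : ι → Finset α) :
    ∑ m ∈ S, ((S.erase m).biUnion A).card + 2 * (S.biUnion A).card ≤
      ∑ m ∈ S, (A m).card + S.card * (S.biUnion A).card := by
  set U := S.biUnion A with hU
  have key : ∀ x ∈ U, (∑ m ∈ S, if x ∈ (S.erase m).biUnion A then 1 else 0) + 2 ≤
      (∑ m ∈ S, if x ∈ A m then 1 else 0) + S.card := by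
    intro x hx
    obtain ⟨a, ha, hxa⟩ := Finset.mem_biUnion.1 hx
    simp only [← Finset.card_filter]
    by_cases h : ∃ b ∈ S, b ≠ a ∧ x ∈ A b
    · obtain ⟨b, hb, hba, hxb⟩ := h
      have h1 := Finset.card_filter_le S (fun m => x ∈ (S.erase m).biUnion A)
      have h2 : 1 < (S.filter (fun m => x ∈ A m)).card :=
        Finset.one_lt_card.2 ⟨b, by simp [*], a, by simp [*], hba⟩
      omega
    · have h1 : (S.filter (fun m => x ∈ (S.erase m).biUnion A)).card < S.card := by
        refine Finset.card_lt_card (Finset.filter_ssubset.2 ⟨a, ha, fun hc => h ?_⟩)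
        obtain ⟨b, hb, hxb⟩ := Finset.mem_biUnion.1 hc
        exact ⟨b, Finset.mem_of_mem_erase hb, Finset.ne_of_mem_erase hb, hxb⟩
      have h2 : 0 < (S.filter (fun m => x ∈ A m)).card :=
        Finset.card_pos.2 ⟨a, by simp [*]⟩
      omega
  have card_eq : ∀ B ⊆ U, B.card = ∑ x ∈ U, if x ∈ B then 1 else 0 := by
    intro B hB
    rw [← Finset.card_filter, Finset.filter_mem_eq_inter, Finset.inter_eq_right.2 hB]
  have h := Finset.sum_le_sum key
  rw [Finset.sum_add_distrib, Finset.sum_add_distrib, Finset.sum_comm,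
    Finset.sum_comm (s := U)] at h
  rw [Finset.sum_congr rfl fun m _ => card_eq _
      (Finset.biUnion_subset_biUnion_of_subset_left A (S.erase_subset m)),
    Finset.sum_congr rfl fun m hm => card_eq (A m) (Finset.subset_biUnion_of_mem A hm)]
  simpa [mul_comm] using h

/-- Some member of a nonempty family can be removed so that the excess of the sum of the sizes
over the size of the union shrinks by a factor at most `(s - 2) / s`. -/
theorem Finset.exists_mem_card_biUnion_erase_le {ι α : Type*} [DecidableEq ι] [DecidableEq α]
    {S : Finset ι} (hS : S.Nonempty) (A : ι → Finset α) :
    ∃ m ∈ S, S.card * ((S.erase m).biUnion A).card + 2 * (S.biUnion A).card ≤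
      ∑ m ∈ S, (A m).card + S.card * (S.biUnion A).card := by
  obtain ⟨m, hm, hmin⟩ := S.exists_min_image (fun m => ((S.erase m).biUnion A).card) hS
  refine ⟨m, hm, le_trans ?_ (S.sum_card_biUnion_erase_add_le A)⟩
  have h := S.card_nsmul_le_sum _ _ hmin
  simpa using h

theorem exists_small_union (n r M N : ℕ) (hM : 2 ≤ M) (hN : N ≤ M)
    (A : Fin M → Finset (Fin n)) (hA : ∀ m : Fin M, (A m).card = r + 1) :
    ∃ S : Finset (Fin M), S.card = N ∧
      ((S.biUnion A).card : ℚ) ≤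
        (N : ℚ) * ((r : ℚ) + 1) -
          ((N : ℚ) * ((N : ℚ) - 1)) / ((M : ℚ) * ((M : ℚ) - 1)) *
            ((M : ℚ) * ((r : ℚ) + 1) - (n : ℚ)) := by
  have hM' : (2 : ℚ) ≤ M := by exact_mod_cast hM
  induction hN using Nat.decreasingInduction with
  | self =>
    refine ⟨Finset.univ, by simp, ?_⟩
    have h : ((Finset.univ.biUnion A).card : ℚ) ≤ n := by
      exact_mod_cast (Finset.card_le_univ _).trans_eq (Fintype.card_fin n)
    rw [div_self (by nlinarith)]
    linarith
  | of_succ N hN ih =>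
    obtain rfl | hpos := Nat.eq_zero_or_pos N
    · exact ⟨∅, by simp⟩
    obtain ⟨S, hS, hSU⟩ := ih
    obtain ⟨m, hm, hle⟩ := Finset.exists_mem_card_biUnion_erase_le
      (Finset.card_pos.1 (by omega : 0 < S.card)) A
    refine ⟨S.erase m, by rw [Finset.card_erase_of_mem hm, hS]; rfl, ?_⟩
    simp only [hA, Finset.sum_const, hS, smul_eq_mul] at hle
    have hle' : ((N : ℚ) + 1) * ((S.erase m).biUnion A).card + 2 * (S.biUnion A).card ≤
        (N + 1) * (r + 1) + (N + 1) * (S.biUnion A).card := by exact_mod_cast hle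
    have hN1 : (1 : ℚ) ≤ N := by exact_mod_cast hpos
    push_cast at hSU
    rw [div_mul_eq_mul_div, mul_div_assoc] at hSU ⊢
    set q := ((M : ℚ) * (r + 1) - n) / (M * (M - 1))
    have h := mul_le_mul_of_nonneg_left hSU (sub_nonneg.2 hN1)
    refine le_of_mul_le_mul_left ?_ (by positivity : (0 : ℚ) < N + 1)
    linarith
end

section
/- Let n, r, t, s be nonnegative integers with t ≥ 1, let j ∈ [n], and let Γ₁,…,Γ_t be subsets of [n] such that j ∈ Γ_l and |Γ_l| = r+1 for every l, |Γ_{l₁} ∩ Γ_{l₂}| = s+1 for all distinct l₁, l₂ ∈ [t], and Γ_{l₁} ∩ Γ_{l₂} ∩ Γ_{l₃} = {j} for all pairwise distinct l₁, l₂, l₃ ∈ [t]. Then for every L with 1 ≤ L ≤ t, |⋃_{l=1}^{L} Γ_l| = N_e(r,L,s) = 1 + Lr − s·L(L−1)/2. -/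
/-- Cardinality of a union of sets of size `r` whose pairwise intersections have size `s` and whose
triple intersections are empty. -/
theorem card_biUnion_of_inter_inter_eq_empty {ι α : Type*} [DecidableEq ι] [DecidableEq α]
    (A : ι → Finset α) (r s : ℕ) (hcard : ∀ i, (A i).card = r)
    (hpair : ∀ i k, i ≠ k → (A i ∩ A k).card = s)
    (htriple : ∀ i k l, i ≠ k → i ≠ l → k ≠ l → A i ∩ A k ∩ A l = ∅) (S : Finset ι) :
    ((S.biUnion A).card : ℚ) = S.card * r - s * S.card * (S.card - 1) / 2 := by
  induction S using Finset.induction_on with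
  | empty => simp
  | insert a S ha ih =>
    have hinter : (A a ∩ S.biUnion A).card = S.card * s := by
      rw [Finset.inter_biUnion, Finset.card_biUnion]
      · exact Finset.sum_const_nat fun i hi => hpair a i (ne_of_mem_of_not_mem hi ha).symm
      · intro i hi k hk hik
        rw [Function.onFun, Finset.disjoint_iff_inter_eq_empty, ← Finset.inter_inter_distrib_left,
          ← Finset.inter_assoc]
        exact htriple a i k (ne_of_mem_of_not_mem hi ha).symm
          (ne_of_mem_of_not_mem hk ha).symm hik
    have hunion := Finset.card_union_add_card_inter (A a) (S.biUnion A)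
    rw [hinter, hcard] at hunion
    have hunion' : ((A a ∪ S.biUnion A).card : ℚ) + S.card * s = r + (S.biUnion A).card := by
      exact_mod_cast hunion
    rw [Finset.biUnion_insert, Finset.card_insert_of_notMem ha]
    push_cast
    linarith

theorem card_union_exact_recovery_sets (n r t s : ℕ) (ht : 1 ≤ t)
    (j : Fin n) (Γ : Fin t → Finset (Fin n))
    (hmem : ∀ l, j ∈ Γ l) (hcard : ∀ l, (Γ l).card = r + 1)
    (hpair : ∀ l₁ l₂ : Fin t, l₁ ≠ l₂ → (Γ l₁ ∩ Γ l₂).card = s + 1)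
    (htriple : ∀ l₁ l₂ l₃ : Fin t, l₁ ≠ l₂ → l₁ ≠ l₃ → l₂ ≠ l₃ →
      Γ l₁ ∩ Γ l₂ ∩ Γ l₃ = {j}) :
    ∀ L : ℕ, 1 ≤ L → L ≤ t →
      ((((Finset.univ : Finset (Fin t)).filter
          (fun l : Fin t => (l : ℕ) < L)).biUnion Γ).card : ℚ)
        = 1 + (L : ℚ) * (r : ℚ) - (s : ℚ) * (L : ℚ) * ((L : ℚ) - 1) / 2 := by
  intro L hL hLt
  set S := (Finset.univ : Finset (Fin t)).filter (fun l : Fin t => (l : ℕ) < L) with hS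
  have hScard : S.card = L := by
    rw [hS, Fin.card_filter_val_lt, min_eq_right hLt]
  have herase_inter (s u : Finset (Fin n)) : s.erase j ∩ u.erase j = (s ∩ u).erase j := by
    grind
  have herase := card_biUnion_of_inter_inter_eq_empty (fun l => (Γ l).erase j) r s
    (fun l => by simp [Finset.card_erase_of_mem (hmem l), hcard])
    (fun l₁ l₂ h => by
      rw [herase_inter,
        Finset.card_erase_of_mem (Finset.mem_inter.2 ⟨hmem l₁, hmem l₂⟩), hpair _ _ h]
      simp)
    (fun l₁ l₂ l₃ h₁₂ h₁₃ h₂₃ => by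
      rw [herase_inter, herase_inter,
        htriple _ _ _ h₁₂ h₁₃ h₂₃]
      simp) S
  have hj : j ∈ S.biUnion Γ :=
    Finset.mem_biUnion.2 ⟨⟨0, ht⟩, by simp [hS]; omega, hmem _⟩
  rw [← Finset.erase_biUnion, hScard] at herase
  rw [← Finset.card_erase_add_one hj]
  push_cast
  linarith
end

section
/- Let (Γ_l(j))_{1≤l≤t, 1≤j≤n} be a family of subsets of [n] satisfying the exact (r,t,s)-condition, let d ≥ 1 with d−1 < n, and let A ⊆ [n] be a set with n−|A| ≥ d−1 and n−|A| ≥ N_e(r,t,s). Then there exist pairwise distinct j₁,…,j_N ∈ [n]∖A with N = (d−1) + ⌈(n−|A|)·f̃_e(n−|A|, d−1, r, t, s)⌉ such that for every k with d ≤ k ≤ N there is at least one α ∈ [t] with Γ_α(j_k) ∩ {j₁, j₂, …, j_{k−1}} = ∅. -/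
/-- The family `(Γ_l(j))` of subsets of `[n]` satisfies the exact `(r,t,s)`-condition. -/
def ExactCondition (n r t s : ℕ) (Γ : Fin n → Fin t → Finset (Fin n)) : Prop :=
  (∀ (j : Fin n) (l : Fin t), (Γ j l).card = r + 1 ∧ j ∈ Γ j l) ∧
  (∀ (j : Fin n) (l₁ l₂ : Fin t), l₁ ≠ l₂ → (Γ j l₁ ∩ Γ j l₂).card = s + 1) ∧
  (∀ (j : Fin n) (l₁ l₂ l₃ : Fin t), l₁ ≠ l₂ → l₁ ≠ l₃ → l₂ ≠ l₃ →
    Γ j l₁ ∩ Γ j l₂ ∩ Γ j l₃ = {j})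

/-- `N_e(r,L,s) = 1 + Lr − s·L(L−1)/2` as an integer. -/
def NeZ (r L s : ℕ) : ℤ :=
  1 + (L : ℤ) * (r : ℤ) - (s : ℤ) * ((L * (L - 1)) / 2 : ℕ)

/-- `N_e(r,L,s)` as a rational number. -/
def NeQ (r L s : ℕ) : ℚ :=
  1 + (L : ℚ) * (r : ℚ) - (s : ℚ) * (L : ℚ) * ((L : ℚ) - 1) / 2

/-- The binomial coefficient `C(a,b)` for an integer `a`, with the convention
`C(a,b) = 0` when `a < b`. -/
def chooseQ (a : ℤ) (b : ℕ) : ℚ :=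
  if a < (b : ℤ) then 0 else ((a.toNat).choose b : ℚ)

/-- `f̃_e(m,D,r,t,s) = Σ_{L=1}^{t} (−1)^{L+1}·C(t,L)·[C(m−N_e(r,L,s),D)/C(m,D)]·[1/N_e(r,L,s)]`. -/
def fe (m D r t s : ℕ) : ℚ :=
  ∑ L ∈ Finset.Icc 1 t, (-1 : ℚ) ^ (L + 1) * (t.choose L : ℚ) *
    (chooseQ ((m : ℤ) - NeZ r L s) D / (m.choose D : ℚ)) * (1 / NeQ r L s)

open Finset

/-- In a family of `r`-sets with pairwise intersections of size `s` and empty triple intersections,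
the union of `T` has `|T| r - s C(|T|, 2)` elements. -/
lemma card_biUnion_add_of_pairwise {ι κ : Type*} [DecidableEq ι] [DecidableEq κ]
    (H : κ → Finset ι) (r s : ℕ) (hr : ∀ l, (H l).card = r)
    (hs : ∀ l₁ l₂, l₁ ≠ l₂ → (H l₁ ∩ H l₂).card = s)
    (h3 : ∀ l₁ l₂ l₃, l₁ ≠ l₂ → l₁ ≠ l₃ → l₂ ≠ l₃ → H l₁ ∩ H l₂ ∩ H l₃ = ∅)
    (T : Finset κ) : (T.biUnion H).card + s * T.card.choose 2 = T.card * r := by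
  induction T using Finset.induction_on with
  | empty => simp
  | insert a T ha ih =>
    have hne : ∀ b ∈ T, a ≠ b := fun b hb h => ha (h ▸ hb)
    have hinter : (H a ∩ T.biUnion H).card = T.card * s := by
      rw [inter_biUnion, card_biUnion]
      · rw [sum_congr rfl fun b hb => hs a b (hne b hb)]
        simp
      · intro b hb c hc hbc
        rw [Function.onFun, disjoint_iff_inter_eq_empty, ← inter_inter_distrib_left, ← inter_assoc]
        exact h3 a b c (hne b hb) (hne c hc) hbc
    have hunion := card_union_add_card_inter (H a) (T.biUnion H)
    rw [hr, hinter] at hunion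
    rw [biUnion_insert, card_insert_of_notMem ha, Nat.choose_succ_succ' T.card 1, Nat.choose_one_right]
    linarith [mul_comm T.card s]

/-- The union of a nonempty subfamily of the `Γ_l(j)` has `N_e` elements. -/
lemma ExactCondition.card_biUnion {n r t s : ℕ} {Γ : Fin n → Fin t → Finset (Fin n)}
    (h : ExactCondition n r t s Γ) (j : Fin n) {T : Finset (Fin t)} (hT : T.Nonempty) :
    ((T.biUnion (Γ j)).card : ℤ) = NeZ r T.card s := by
  obtain ⟨h1, h2, h3⟩ := h
  have hmem : ∀ l, j ∈ Γ j l := fun l => (h1 j l).2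
  have herase_inter : ∀ X Y : Finset (Fin n), X.erase j ∩ Y.erase j = (X ∩ Y).erase j := by
    intro X Y
    rw [erase_inter, inter_erase, erase_idem]
  have key := card_biUnion_add_of_pairwise (fun l => (Γ j l).erase j) r s
    (fun l => by rw [card_erase_of_mem (hmem l), (h1 j l).1]; rfl)
    (fun l₁ l₂ hl => by
      rw [herase_inter, card_erase_of_mem (by simp [hmem]), h2 j l₁ l₂ hl]; rfl)
    (fun l₁ l₂ l₃ h12 h13 h23 => by
      rw [herase_inter, herase_inter, h3 j l₁ l₂ l₃ h12 h13 h23]; simp) T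
  have herase : T.biUnion (fun l => (Γ j l).erase j) = (T.biUnion (Γ j)).erase j := by
    ext x; simp; tauto
  obtain ⟨a, ha⟩ := hT
  have hj : j ∈ T.biUnion (Γ j) := mem_biUnion.2 ⟨a, ha, hmem a⟩
  rw [herase] at key
  have hcard := card_erase_add_one hj
  rw [NeZ, ← Nat.choose_two_right]
  zify at key hcard
  linarith

lemma NeQ_eq_NeZ (r L s : ℕ) : NeQ r L s = (NeZ r L s : ℚ) := by
  rw [NeQ, NeZ, ← Nat.choose_two_right]
  push_cast
  rw [Nat.cast_choose_two]
  ring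

/-- The permutations for which `j` comes first in `U` make up a proportion `1 / |U|`. -/
lemma card_perm_first_mul_card {ι : Type*} [Fintype ι] [LinearOrder ι] (U : Finset ι) {j : ι}
    (hj : j ∈ U) :
    #{π : Equiv.Perm ι | ∀ x ∈ U, π j ≤ π x} * U.card = (Fintype.card ι).factorial := by
  have hsymm : ∀ i ∈ U, #{π : Equiv.Perm ι | ∀ x ∈ U, π i ≤ π x}
      = #{π : Equiv.Perm ι | ∀ x ∈ U, π j ≤ π x} := by
    intro i hi
    have hswap : ∀ x ∈ U, Equiv.swap i j x ∈ U := by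
      intro x hx
      rw [Equiv.swap_apply_def]
      split_ifs <;> assumption
    refine card_bij' (fun π _ => π * Equiv.swap i j) (fun π _ => π * Equiv.swap i j) ?_ ?_ ?_ ?_
    · intro π hπ
      simp only [mem_filter, mem_univ, true_and, Equiv.Perm.mul_apply, Equiv.swap_apply_right]
        at hπ ⊢
      exact fun x hx => hπ _ (hswap x hx)
    · intro π hπ
      simp only [mem_filter, mem_univ, true_and, Equiv.Perm.mul_apply, Equiv.swap_apply_left]
        at hπ ⊢
      exact fun x hx => hπ _ (hswap x hx)
    · intro π _; simp [mul_assoc]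
    · intro π _; simp [mul_assoc]
  have hcover : (U.biUnion fun i => {π : Equiv.Perm ι | ∀ x ∈ U, π i ≤ π x}) = univ := by
    ext π
    simp only [mem_biUnion, mem_filter, mem_univ, true_and, iff_true]
    exact exists_min_image U π ⟨j, hj⟩
  have hcard := congrArg Finset.card hcover
  rw [card_biUnion, sum_congr rfl hsymm, sum_const, smul_eq_mul, card_univ,
    Fintype.card_perm] at hcard
  · rw [mul_comm, hcard]
  · intro a ha b hb hab
    rw [Function.onFun, disjoint_left]
    intro π h₁ h₂
    simp only [mem_filter, mem_univ, true_and] at h₁ h₂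
    exact hab (π.injective (le_antisymm (h₁ b hb) (h₂ a ha)))

lemma card_powersetCard_disjoint {ι : Type*} [DecidableEq ι] {U V : Finset ι} (hUV : U ⊆ V)
    (D : ℕ) : #{E ∈ V.powersetCard D | ∀ x ∈ U, x ∉ E} = (V.card - U.card).choose D := by
  rw [← card_sdiff_of_subset hUV, ← card_powersetCard]
  congr 1
  ext E
  simp only [mem_filter, mem_powersetCard, subset_iff, mem_sdiff]
  grind

/-- Inclusion–exclusion in terms of the number of properties that hold. -/
lemma alternating_sum_Icc_choose {k t : ℕ} (hk : k ≤ t) :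
    ∑ L ∈ Icc 1 t, (-1 : ℤ) ^ (L + 1) * (k.choose L : ℤ) = if k = 0 then 0 else 1 := by
  have h := Int.alternating_sum_range_choose (n := k)
  have hext : ∑ L ∈ range (t + 1), (-1 : ℤ) ^ L * (k.choose L : ℤ)
      = ∑ L ∈ range (k + 1), (-1 : ℤ) ^ L * (k.choose L : ℤ) := by
    symm
    refine sum_subset (range_mono (by omega)) fun L _ hL => ?_
    rw [Nat.choose_eq_zero_of_lt (by simpa using hL)]
    simp
  rw [← hext, sum_range_eq_add_Ico _ (by omega)] at h
  have hIcc : Icc 1 t = Ico 1 (t + 1) := by ext; rw [mem_Icc, mem_Ico, Nat.lt_succ_iff]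
  rw [hIcc]
  simp only [pow_succ, mul_neg_one, neg_mul, sum_neg_distrib]
  split_ifs at h ⊢ <;> simp at h <;> linarith

/-- Inclusion–exclusion when intersections of `L` of the events all have `p L` elements. -/
lemma card_exists_eq_alternating_sum {Ω κ : Type*} [Fintype κ] (S : Finset Ω)
    (P : κ → Ω → Prop) [∀ l, DecidablePred (P l)] (p : ℕ → ℕ)
    (hp : ∀ T : Finset κ, T.Nonempty → #{ω ∈ S | ∀ l ∈ T, P l ω} = p T.card) :
    (#{ω ∈ S | ∃ l, P l ω} : ℤ) = ∑ L ∈ Icc 1 (Fintype.card κ),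
      (-1 : ℤ) ^ (L + 1) * ((Fintype.card κ).choose L : ℤ) * (p L : ℤ) := by
  classical
  have hcount : ∀ L ∈ Icc 1 (Fintype.card κ),
      ∑ ω ∈ S, (#{l | P l ω}).choose L = (Fintype.card κ).choose L * p L := by
    intro L hL
    have hω : ∀ ω ∈ S, (#{l | P l ω}).choose L
        = ∑ T ∈ (univ : Finset κ).powersetCard L, if ∀ l ∈ T, P l ω then 1 else 0 := by
      intro ω _
      rw [← card_powersetCard, ← card_filter]
      congr 1
      ext T
      simp [mem_powersetCard, subset_iff]
      tauto
    rw [sum_congr rfl hω, sum_comm]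
    have hT : ∀ T ∈ (univ : Finset κ).powersetCard L,
        (∑ ω ∈ S, if ∀ l ∈ T, P l ω then 1 else 0) = p L := by
      intro T hT
      rw [mem_powersetCard] at hT
      have hTne : T.Nonempty := card_pos.1 (by have := (mem_Icc.1 hL).1; omega)
      rw [← card_filter, ← hT.2, ← hp T hTne]
      congr!
    rw [sum_congr rfl hT, sum_const, card_powersetCard, card_univ, smul_eq_mul]
  have hind : ∀ ω ∈ S, ((if ∃ l, P l ω then 1 else 0 : ℕ) : ℤ)
      = ∑ L ∈ Icc 1 (Fintype.card κ), (-1 : ℤ) ^ (L + 1) * ((#{l | P l ω}).choose L : ℤ) := by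
    intro ω _
    rw [alternating_sum_Icc_choose (card_le_univ _)]
    by_cases h : ∃ l, P l ω
    · have : #{l | P l ω} ≠ 0 := by
        obtain ⟨l, hl⟩ := h
        exact card_ne_zero_of_mem (a := l) (by simpa using hl)
      simp [h, this]
    · have : #{l | P l ω} = 0 := by
        push Not at h
        simp [h]
      simp [h, this]
  rw [card_filter, Nat.cast_sum, sum_congr rfl hind, sum_comm]
  refine sum_congr rfl fun L hL => ?_
  rw [← mul_sum, mul_assoc]
  congr 1
  exact_mod_cast hcount L hL

/-- A set no larger than `V` can be mapped injectively into `V` fixing its elements in `V`. -/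
lemma exists_injOn_mapsTo_fixing {ι : Type*} [DecidableEq ι] (U V : Finset ι)
    (h : U.card ≤ V.card) :
    ∃ φ : ι → ι, Set.InjOn φ U ∧ (∀ x ∈ U, φ x ∈ V) ∧ ∀ x ∈ U, x ∈ V → φ x = x := by
  obtain ⟨W, hW₁, hW₂, hW₃⟩ := exists_subsuperset_card_eq (s := U ∩ V) (t := V) (n := U.card)
    inter_subset_right (card_le_card inter_subset_left) h
  obtain ⟨g, hg⟩ := exists_equiv_extend_of_card_eq (α := U) (t := W) (by simp [hW₃])
    (s := univ.filter fun x => (x : ι) ∈ V) (f := fun x => (x : ι))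
    (by
      intro x hx
      simp only [mem_image, mem_filter, mem_univ, true_and] at hx
      obtain ⟨y, hy, rfl⟩ := hx
      exact hW₁ (mem_inter.2 ⟨y.2, hy⟩))
    Subtype.val_injective.injOn
  refine ⟨fun x => if hx : x ∈ U then g ⟨x, hx⟩ else x, ?_, ?_, ?_⟩
  · intro x hx y hy hxy
    have hx' : x ∈ U := hx
    have hy' : y ∈ U := hy
    simp only [hx', hy', dif_pos] at hxy
    simpa using g.injective (Subtype.ext hxy)
  · intro x hx
    simp only [hx, dif_pos]
    exact hW₂ (g ⟨x, hx⟩).2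
  · intro x hx hxV
    simp only [hx, dif_pos]
    exact hg ⟨x, hx⟩ (by simpa using hxV)

/-- The number of pairs (permutation, `D`-subset of `V`) such that some `G_l` avoids the `D`-subset
and has `j` as its first element. -/
lemma card_exists_first_and_disjoint {ι κ : Type*} [Fintype ι] [LinearOrder ι] [Fintype κ]
    (V : Finset ι) (D : ℕ) (G : κ → Finset ι) (j : ι) (hj : ∀ l, j ∈ G l)
    (hGV : ∀ l, G l ⊆ V) (N : ℕ → ℕ)
    (hN : ∀ T : Finset κ, T.Nonempty → (T.biUnion G).card = N T.card) :
    (#{ω ∈ (univ : Finset (Equiv.Perm ι)) ×ˢ V.powersetCard D |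
        ∃ l, ∀ x ∈ G l, ω.1 j ≤ ω.1 x ∧ x ∉ ω.2} : ℤ)
      = ∑ L ∈ Icc 1 (Fintype.card κ), (-1 : ℤ) ^ (L + 1) * ((Fintype.card κ).choose L : ℤ) *
        ((((Fintype.card ι).factorial / N L) * (V.card - N L).choose D : ℕ) : ℤ) := by
  refine card_exists_eq_alternating_sum _ 
    (fun l (ω : Equiv.Perm ι × Finset ι) => ∀ x ∈ G l, ω.1 j ≤ ω.1 x ∧ x ∉ ω.2)
    (fun L => (Fintype.card ι).factorial / N L * (V.card - N L).choose D) ?_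
  intro T hT
  rw [← hN T hT]
  have hjT : j ∈ T.biUnion G := by
    obtain ⟨a, ha⟩ := hT
    exact mem_biUnion.2 ⟨a, ha, hj a⟩
  rw [← card_powersetCard_disjoint (biUnion_subset.2 fun l _ => hGV l) D,
    ← card_perm_first_mul_card _ hjT, Nat.mul_div_cancel _ (card_pos.2 ⟨j, hjT⟩), ← card_product]
  congr 1
  ext ω
  simp only [mem_filter, mem_product, mem_univ, true_and, mem_biUnion]
  grind

lemma exists_perm_and_powersetCard_many_first (n r t s D : ℕ)
    (Γ : Fin n → Fin t → Finset (Fin n)) (hexact : ExactCondition n r t s Γ)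
    (V : Finset (Fin n)) (hD : D ≤ V.card) (hV : NeZ r t s ≤ (V.card : ℤ)) :
    ∃ π : Equiv.Perm (Fin n), ∃ E ∈ V.powersetCard D,
      (V.card : ℚ) * fe V.card D r t s ≤
        #{j ∈ V | ∃ l, ∀ x ∈ Γ j l, x ∈ V → π j ≤ π x ∧ x ∉ E} := by
  set S := (univ : Finset (Equiv.Perm (Fin n))) ×ˢ V.powersetCard D with hS
  have hSne : S.Nonempty := univ_nonempty.product (powersetCard_nonempty.2 hD)
  have hScard : (S.card : ℚ) = n.factorial * V.card.choose D := by
    rw [hS, card_product, card_univ, Fintype.card_perm, card_powersetCard]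
    simp
  have hpoint : ∀ j ∈ V, (S.card : ℚ) * fe V.card D r t s ≤
      #{ω ∈ S | ∃ l, ∀ x ∈ Γ j l, x ∈ V → ω.1 j ≤ ω.1 x ∧ x ∉ ω.2} := by
    intro j hjV
    have hUcard : (univ.biUnion (Γ j)).card ≤ V.card := by
      rcases t.eq_zero_or_pos with rfl | ht
      · simp
      · have := hexact.card_biUnion j (T := univ) ⟨⟨0, ht⟩, mem_univ _⟩
        rw [card_univ, Fintype.card_fin] at this
        omega
    obtain ⟨φ, hφinj, hφV, hφfix⟩ := exists_injOn_mapsTo_fixing _ V hUcard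
    have hsub : ∀ l, Γ j l ⊆ univ.biUnion (Γ j) := fun l => subset_biUnion_of_mem _ (mem_univ l)
    have hjΓ : ∀ l, j ∈ Γ j l := fun l => (hexact.1 j l).2
    have hcardφ : ∀ T : Finset (Fin t), T.Nonempty →
        (T.biUnion fun l => (Γ j l).image φ).card = (NeZ r T.card s).toNat := by
      intro T hT
      rw [← biUnion_image, card_image_of_injOn, ← hexact.card_biUnion j hT, Int.toNat_natCast]
      exact hφinj.mono (by exact_mod_cast biUnion_subset_biUnion_of_subset_left _ (subset_univ T))
    have hcount := card_exists_first_and_disjoint V D (fun l => (Γ j l).image φ) j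
      (fun l => mem_image.2 ⟨j, hjΓ l, hφfix j (hsub l (hjΓ l)) hjV⟩)
      (fun l => image_subset_iff.2 fun x hx => hφV x (hsub l hx))
      (fun L => (NeZ r L s).toNat) hcardφ
    have hfe : (S.card : ℚ) * fe V.card D r t s = #{ω ∈ S |
        ∃ l, ∀ x ∈ (Γ j l).image φ, ω.1 j ≤ ω.1 x ∧ x ∉ ω.2} := by
      have hcast := congrArg (Int.cast : ℤ → ℚ) hcount
      rw [Int.cast_natCast] at hcast
      refine Eq.trans ?_ (hcast.symm.trans (by congr!))
      rw [hScard, fe, mul_sum]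
      simp only [Int.cast_sum, Int.cast_mul, Int.cast_pow, Int.cast_neg, Int.cast_one,
        Int.cast_natCast, Nat.cast_mul, Fintype.card_fin]
      refine sum_congr rfl fun L hL => ?_
      obtain ⟨T, -, hTL⟩ := exists_subset_card_eq (s := (univ : Finset (Fin t))) (n := L)
        (by simpa using (mem_Icc.1 hL).2)
      have hTne : T.Nonempty := card_pos.1 (by have := (mem_Icc.1 hL).1; omega)
      have hNe := hexact.card_biUnion j hTne
      rw [hTL] at hNe
      have hjT : j ∈ T.biUnion (Γ j) := by
        obtain ⟨a, ha⟩ := hTne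
        exact mem_biUnion.2 ⟨a, ha, hjΓ a⟩
      have hle : (T.biUnion (Γ j)).card ≤ V.card :=
        (card_le_card (biUnion_subset_biUnion_of_subset_left _ (subset_univ T))).trans hUcard
      have hdvd : (T.biUnion (Γ j)).card ∣ n.factorial := by
        have := card_perm_first_mul_card _ hjT
        rw [Fintype.card_fin] at this
        exact Dvd.intro_left _ this
      have hpos : ((T.biUnion (Γ j)).card : ℚ) ≠ 0 := by
        exact_mod_cast card_ne_zero_of_mem hjT
      have hchoose : (V.card.choose D : ℚ) ≠ 0 := by exact_mod_cast (Nat.choose_pos hD).ne'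
      have hchooseQ : chooseQ ((V.card : ℤ) - ((T.biUnion (Γ j)).card : ℤ)) D
          = ((V.card - (T.biUnion (Γ j)).card).choose D : ℚ) := by
        rw [chooseQ, ← Nat.cast_sub hle]
        split_ifs with h
        · rw [Nat.choose_eq_zero_of_lt (by exact_mod_cast h), Nat.cast_zero]
        · rw [Int.toNat_natCast]
      rw [NeQ_eq_NeZ, ← hNe, hchooseQ, Int.toNat_natCast, Int.cast_natCast,
        Nat.cast_div hdvd hpos]
      field_simp
    rw [hfe]
    refine Nat.cast_le.2 (card_le_card fun ω hω => ?_)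
    rw [mem_filter] at hω ⊢
    obtain ⟨hωS, l, hl⟩ := hω
    exact ⟨hωS, l, fun x hx hxV => hl x (mem_image.2 ⟨x, hx, hφfix x (hsub l hx) hxV⟩)⟩
  have hsum : ∑ _ω ∈ S, (V.card : ℚ) * fe V.card D r t s ≤ ∑ ω ∈ S,
      (#{j ∈ V | ∃ l, ∀ x ∈ Γ j l, x ∈ V → ω.1 j ≤ ω.1 x ∧ x ∉ ω.2} : ℚ) := by
    have hswap : ∑ ω ∈ S,
        (#{j ∈ V | ∃ l, ∀ x ∈ Γ j l, x ∈ V → ω.1 j ≤ ω.1 x ∧ x ∉ ω.2} : ℚ)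
        = ∑ j ∈ V, (#{ω ∈ S | ∃ l, ∀ x ∈ Γ j l, x ∈ V → ω.1 j ≤ ω.1 x ∧ x ∉ ω.2} : ℚ) := by
      simp only [card_filter, Nat.cast_sum]
      exact sum_comm
    rw [hswap]
    calc ∑ _ω ∈ S, (V.card : ℚ) * fe V.card D r t s
        = ∑ _j ∈ V, (S.card : ℚ) * fe V.card D r t s := by
          simp only [sum_const, nsmul_eq_mul]; ring
      _ ≤ _ := sum_le_sum hpoint
  obtain ⟨ω, hω, hle⟩ := exists_le_of_sum_le hSne hsum
  exact ⟨ω.1, ω.2, (mem_product.1 hω).2, hle⟩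

/-- A set `E` followed by the elements of a disjoint set `B` in the order given by `π`. -/
lemma exists_injective_append_ordered {ι : Type*} [LinearOrder ι] (π : Equiv.Perm ι)
    {E B : Finset ι} {p q : ℕ} (hE : E.card = p) (hB : B.card = q) (hEB : Disjoint E B) :
    ∃ f : Fin (p + q) → ι, Function.Injective f ∧ (∀ i : Fin p, f (Fin.castAdd q i) ∈ E) ∧
      (∀ i : Fin q, f (Fin.natAdd p i) ∈ B) ∧
      ∀ i k : Fin q, i < k → π (f (Fin.natAdd p i)) < π (f (Fin.natAdd p k)) := by
  have hB' : (B.image π).card = q := by rw [card_image_of_injective _ π.injective, hB]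
  set e := E.orderEmbOfFin hE with he
  set b := (B.image π).orderEmbOfFin hB' with hb
  have hbmem : ∀ i, π.symm (b i) ∈ B := by
    intro i
    obtain ⟨x, hx, hxi⟩ := mem_image.1 (orderEmbOfFin_mem (B.image π) hB' i)
    rw [hb, ← hxi, Equiv.symm_apply_apply]
    exact hx
  have hemem : ∀ i, e i ∈ E := fun i => orderEmbOfFin_mem E hE i
  refine ⟨Fin.append e fun i => π.symm (b i), ?_, ?_, ?_, ?_⟩
  · rw [Fin.append_injective_iff]
    exact ⟨e.injective, π.symm.injective.comp b.injective,
      fun i k h => disjoint_left.1 hEB (hemem i) (h ▸ hbmem k)⟩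
  · intro i; simpa using hemem i
  · intro i; simpa using hbmem i
  · intro i k hik; simpa using hik

theorem exists_recoverable_sequence_avoiding' (n r t s d : ℕ)
    (Γ : Fin n → Fin t → Finset (Fin n)) (hexact : ExactCondition n r t s Γ)
    (hd : 1 ≤ d) (hdn : d - 1 < n)
    (A : Finset (Fin n)) (hA : d - 1 ≤ n - A.card)
    (hA' : NeZ r t s ≤ ((n - A.card : ℕ) : ℤ)) :
    ∃ f : Fin ((d - 1) +
        (⌈((n - A.card : ℕ) : ℚ) * fe (n - A.card) (d - 1) r t s⌉).toNat) → Fin n,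
      Function.Injective f ∧ (∀ k, f k ∉ A) ∧
      ∀ k : Fin ((d - 1) +
          (⌈((n - A.card : ℕ) : ℚ) * fe (n - A.card) (d - 1) r t s⌉).toNat),
        d ≤ (k : ℕ) + 1 →
        ∃ α : Fin t, ∀ i : Fin ((d - 1) +
            (⌈((n - A.card : ℕ) : ℚ) * fe (n - A.card) (d - 1) r t s⌉).toNat),
          i < k → f i ∉ Γ (f k) α := by
  have hVcard : Aᶜ.card = n - A.card := by rw [card_compl, Fintype.card_fin]
  rw [← hVcard] at hA hA' ⊢
  obtain ⟨π, E, hE, hcount⟩ :=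
    exists_perm_and_powersetCard_many_first n r t s (d - 1) Γ hexact Aᶜ hA hA'
  rw [mem_powersetCard] at hE
  obtain ⟨B, hBsub, hB⟩ := exists_subset_card_eq
    (Int.toNat_le.2 (Int.ceil_le.2 (by exact_mod_cast hcount)))
  have hBgood : ∀ j ∈ B, j ∈ Aᶜ ∧ ∃ l, ∀ x ∈ Γ j l, x ∈ Aᶜ → π j ≤ π x ∧ x ∉ E :=
    fun j hj => mem_filter.1 (hBsub hj)
  have hdisj : Disjoint E B := by
    rw [disjoint_right]
    intro j hj
    obtain ⟨hjV, l, hl⟩ := hBgood j hj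
    exact (hl j (hexact.1 j l).2 hjV).2
  obtain ⟨f, hinj, hfE, hfB, hlt⟩ := exists_injective_append_ordered π hE.2 hB hdisj
  have hfV : ∀ k, f k ∈ Aᶜ :=
    Fin.addCases (fun i => hE.1 (hfE i)) (fun i => (hBgood _ (hfB i)).1)
  refine ⟨f, hinj, fun k => mem_compl.1 (hfV k), fun k => ?_⟩
  refine Fin.addCases (fun k hk => ?_) (fun k _ => ?_) k
  · have := k.isLt
    simp only [Fin.val_castAdd] at hk
    omega
  · obtain ⟨-, l, hl⟩ := hBgood _ (hfB k)
    refine ⟨l, fun i => Fin.addCases (fun i _ hi => ?_) (fun i hik hi => ?_) i⟩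
    · exact (hl _ hi (hfV _)).2 (hfE i)
    · exact (hl _ hi (hfV _)).1.not_gt (hlt i k (by simpa using hik))
end

section
/- Let r be an odd positive integer and let H be a matrix over F₂ such that: every column of H has exactly t nonzero entries; every row of H has exactly r+1 nonzero entries; the supports of any two distinct rows intersect in either 0 or exactly 2 positions; and the supports of any three pairwise distinct rows intersect in either 0 or exactly 1 position (i.e., the Tanner graph of H is (r,t,1)-exact). Then H·Hᵀ = 0 over F₂; equivalently, the row space of H is contained in the kernel of H. -/
theorem ZMod.two_mul_eq_ite (a b : ZMod 2) :
    a * b = if a ≠ 0 ∧ b ≠ 0 then 1 else 0 := by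
  revert a b
  decide

theorem Matrix.mul_transpose_apply_eq_card {W V : Type*} [Fintype V]
    (H : Matrix W V (ZMod 2)) (w w' : W) :
    (H * H.transpose) w w' =
      ((Finset.univ.filter (fun v : V => H w v ≠ 0 ∧ H w' v ≠ 0)).card : ZMod 2) := by
  simp only [Matrix.mul_apply, Matrix.transpose_apply, ZMod.two_mul_eq_ite, Finset.sum_boole]

theorem exact_tanner_self_orthogonal {W V : Type*} [Fintype W] [Fintype V]
    (r t : ℕ) (hr : 0 < r) (hodd : Odd r)
    (H : Matrix W V (ZMod 2))
    (hcol : ∀ v : V, (Finset.univ.filter (fun w : W => H w v ≠ 0)).card = t)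
    (hrow : ∀ w : W, (Finset.univ.filter (fun v : V => H w v ≠ 0)).card = r + 1)
    (hpair : ∀ w w' : W, w ≠ w' →
      (Finset.univ.filter (fun v : V => H w v ≠ 0 ∧ H w' v ≠ 0)).card = 0 ∨
      (Finset.univ.filter (fun v : V => H w v ≠ 0 ∧ H w' v ≠ 0)).card = 2)
    (htriple : ∀ w w' w'' : W, w ≠ w' → w ≠ w'' → w' ≠ w'' →
      (Finset.univ.filter
        (fun v : V => H w v ≠ 0 ∧ H w' v ≠ 0 ∧ H w'' v ≠ 0)).card = 0 ∨
      (Finset.univ.filter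
        (fun v : V => H w v ≠ 0 ∧ H w' v ≠ 0 ∧ H w'' v ≠ 0)).card = 1) :
    H * H.transpose = 0 := by
  ext w w'
  rw [Matrix.mul_transpose_apply_eq_card, Matrix.zero_apply, ZMod.natCast_eq_zero_iff_even]
  rcases eq_or_ne w w' with rfl | hne
  · simp only [and_self, hrow]
    exact hodd.add_one
  · rcases hpair w w' hne with h | h <;> simp [h]
end

section
/- Let V₁, W₁, V₂, W₂ be finite index sets and let H₁ (rows W₁, columns V₁) and H₂ (rows W₂, columns V₂) be matrices over F₂ satisfying H₁H₁ᵀ = 0, H₁ᵀH₁ = 0, H₂H₂ᵀ = 0 and H₂ᵀH₂ = 0 (as holds when the Tanner graphs of H₁, H₂ and their transposes are exact with odd rᵢ and even tᵢ). Let H be the product check matrix of H₁ and H₂. Then H·Hᵀ = 0 over F₂; i.e., any two rows of H have inner product 0. -/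
/-- The product check matrix of `H₁` and `H₂`, with rows indexed by
`(V₁×W₂) ⊕ (W₁×V₂)` and columns indexed by `(W₁×W₂) ⊕ (V₁×V₂)`. -/
def prodCheck {V₁ W₁ V₂ W₂ : Type*}
    [DecidableEq V₁] [DecidableEq W₁] [DecidableEq V₂] [DecidableEq W₂]
    (H₁ : Matrix W₁ V₁ (ZMod 2)) (H₂ : Matrix W₂ V₂ (ZMod 2)) :
    Matrix (V₁ × W₂ ⊕ W₁ × V₂) (W₁ × W₂ ⊕ V₁ × V₂) (ZMod 2) :=
  fun i j =>
    match i, j with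
    | Sum.inl (v, w₂'), Sum.inl (w₁, w₂) => if w₂' = w₂ then H₁ w₁ v else 0
    | Sum.inl (v, w₂'), Sum.inr (v₁, v₂) => if v = v₁ then H₂ w₂' v₂ else 0
    | Sum.inr (w₁', v'), Sum.inl (w₁, w₂) => if w₁' = w₁ then H₂ w₂ v' else 0
    | Sum.inr (w₁', v'), Sum.inr (v₁, v₂) => if v' = v₂ then H₁ w₁' v₁ else 0

open scoped Kronecker in
theorem prodCheck_eq_fromBlocks {V₁ W₁ V₂ W₂ : Type*}
    [DecidableEq V₁] [DecidableEq W₁] [DecidableEq V₂] [DecidableEq W₂]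
    (H₁ : Matrix W₁ V₁ (ZMod 2)) (H₂ : Matrix W₂ V₂ (ZMod 2)) :
    prodCheck H₁ H₂ = Matrix.fromBlocks (H₁.transpose ⊗ₖ 1) (1 ⊗ₖ H₂)
      (1 ⊗ₖ H₂.transpose) (H₁ ⊗ₖ 1) := by
  ext (⟨a, b⟩ | ⟨a, b⟩) (⟨c, d⟩ | ⟨c, d⟩) <;>
    simp [prodCheck, Matrix.kroneckerMap_apply, Matrix.one_apply]

theorem prodCheck_self_orthogonal {V₁ W₁ V₂ W₂ : Type*}
    [Fintype V₁] [Fintype W₁] [Fintype V₂] [Fintype W₂]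
    [DecidableEq V₁] [DecidableEq W₁] [DecidableEq V₂] [DecidableEq W₂]
    (H₁ : Matrix W₁ V₁ (ZMod 2)) (H₂ : Matrix W₂ V₂ (ZMod 2))
    (h₁ : H₁ * H₁.transpose = 0) (h₁' : H₁.transpose * H₁ = 0)
    (h₂ : H₂ * H₂.transpose = 0) (h₂' : H₂.transpose * H₂ = 0) :
    prodCheck H₁ H₂ * (prodCheck H₁ H₂).transpose = 0 := by
  rw [prodCheck_eq_fromBlocks, Matrix.fromBlocks_transpose, Matrix.fromBlocks_multiply]
  simp [← Matrix.kroneckerMap_transpose, ← Matrix.mul_kronecker_mul, h₁, h₁', h₂, h₂']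
  ext (i | i) (j | j) <;> simp [CharTwo.add_self_eq_zero]
end

section
/- Let V₁, W₁, V₂, W₂ be finite index sets, H₁ (rows W₁, columns V₁) and H₂ (rows W₂, columns V₂) matrices over F₂, and H their product check matrix. (1) If u₁ ∈ F₂^{V₁} satisfies H₁u₁ = 0 and u₂ ∈ F₂^{V₂} satisfies H₂u₂ = 0, then the vector x ∈ F₂^{(W₁×W₂) ⊔ (V₁×V₂)} defined by x = 0 on the W₁×W₂ block and x(v₁,v₂) = u₁(v₁)·u₂(v₂) on the V₁×V₂ block satisfies Hx = 0. (2) If u₁ᵀ ∈ F₂^{W₁} satisfies H₁ᵀu₁ᵀ = 0 and u₂ᵀ ∈ F₂^{W₂} satisfies H₂ᵀu₂ᵀ = 0, then the vector y defined by y(w₁,w₂) = u₁ᵀ(w₁)·u₂ᵀ(w₂) on the W₁×W₂ block and y = 0 on the V₁×V₂ block satisfies Hy = 0. -/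
theorem sum_ite_fst_mul_tensor {R α β : Type*} [CommSemiring R] [Fintype α] [Fintype β]
    [DecidableEq α] (a : α) (f h : β → R) (g : α → R) :
    ∑ p : α × β, (if a = p.1 then f p.2 else 0) * (g p.1 * h p.2) =
      g a * ∑ b, f b * h b := by
  simp only [Fintype.sum_prod_type, ite_mul, zero_mul, Finset.mul_sum]
  rw [Finset.sum_comm]
  simp [mul_left_comm]

theorem sum_ite_snd_mul_tensor {R α β : Type*} [CommSemiring R] [Fintype α] [Fintype β]
    [DecidableEq β] (b : β) (f g : α → R) (h : β → R) :
    ∑ p : α × β, (if b = p.2 then f p.1 else 0) * (g p.1 * h p.2) =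
      (∑ a, f a * g a) * h b := by
  simp [Fintype.sum_prod_type, Finset.sum_mul, mul_assoc]

theorem tensor_kernel_vectors_in_kernel {V₁ W₁ V₂ W₂ : Type*}
    [Fintype V₁] [Fintype W₁] [Fintype V₂] [Fintype W₂]
    [DecidableEq V₁] [DecidableEq W₁] [DecidableEq V₂] [DecidableEq W₂]
    (H₁ : Matrix W₁ V₁ (ZMod 2)) (H₂ : Matrix W₂ V₂ (ZMod 2)) :
    (∀ (u₁ : V₁ → ZMod 2) (u₂ : V₂ → ZMod 2),
      H₁.mulVec u₁ = 0 → H₂.mulVec u₂ = 0 →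
      (prodCheck H₁ H₂).mulVec
        (Sum.elim (fun _ : W₁ × W₂ => 0)
          (fun p : V₁ × V₂ => u₁ p.1 * u₂ p.2)) = 0) ∧
    (∀ (u₁T : W₁ → ZMod 2) (u₂T : W₂ → ZMod 2),
      H₁.transpose.mulVec u₁T = 0 → H₂.transpose.mulVec u₂T = 0 →
      (prodCheck H₁ H₂).mulVec
        (Sum.elim (fun p : W₁ × W₂ => u₁T p.1 * u₂T p.2)
          (fun _ : V₁ × V₂ => 0)) = 0) := by
  refine ⟨fun u₁ u₂ hu₁ hu₂ => ?_, fun u₁ u₂ hu₁ hu₂ => ?_⟩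
  all_goals
    simp only [funext_iff, Matrix.mulVec, dotProduct, Matrix.transpose_apply,
      Pi.zero_apply] at hu₁ hu₂
    ext (⟨a, b⟩ | ⟨a, b⟩) <;>
      simp only [Matrix.mulVec, dotProduct, Fintype.sum_sum_type, prodCheck, Sum.elim_inl,
        Sum.elim_inr, mul_zero, Finset.sum_const_zero, zero_add, add_zero, Pi.zero_apply]
  · rw [sum_ite_fst_mul_tensor, hu₂, mul_zero]
  · rw [sum_ite_snd_mul_tensor, hu₁, zero_mul]
  · rw [sum_ite_snd_mul_tensor b (fun w => H₁ w a), hu₁, zero_mul]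
  · rw [sum_ite_fst_mul_tensor a (fun w => H₂ w b), hu₂, mul_zero]
end

section
/- Let V₁, W₁, V₂, W₂ be finite index sets, H₁ (rows W₁, columns V₁) and H₂ (rows W₂, columns V₂) matrices over F₂, and H their product check matrix. Let U₁ ⊆ F₂^{V₁}, U₂ ⊆ F₂^{V₂}, U₁ᵀ ⊆ F₂^{W₁}, U₂ᵀ ⊆ F₂^{W₂} be subspaces such that U₁ intersects the span of the rows of H₁ trivially, U₂ intersects the span of the rows of H₂ trivially, U₁ᵀ intersects the span of the columns of H₁ trivially, and U₂ᵀ intersects the span of the columns of H₂ trivially. Let T_{VV} ⊆ F₂^{V₁×V₂} be the span of all vectors (v₁,v₂) ↦ u₁(v₁)·u₂(v₂) with u₁ ∈ U₁, u₂ ∈ U₂, and T_{WW} ⊆ F₂^{W₁×W₂} the span of all vectors (w₁,w₂) ↦ u₁ᵀ(w₁)·u₂ᵀ(w₂) with u₁ᵀ ∈ U₁ᵀ, u₂ᵀ ∈ U₂ᵀ. If a vector y ∈ F₂^{(W₁×W₂) ⊔ (V₁×V₂)} lies in the span of the rows of H, its W₁×W₂-block lies in T_{WW}, and its V₁×V₂-block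 lies in T_{VV}, then y = 0. -/
/-- A submodule of a vector space meeting `R` trivially is fixed by a linear endomorphism
vanishing on `R`. -/
lemma exists_linearMap_fix_of_inf_eq_bot {K M : Type*} [Field K] [AddCommGroup M] [Module K M]
    {U R : Submodule K M} (h : U ⊓ R = ⊥) :
    ∃ P : M →ₗ[K] M, (∀ u ∈ U, P u = u) ∧ ∀ r ∈ R, P r = 0 := by
  obtain ⟨C, hRC, hC⟩ := (disjoint_iff.mpr h).symm.exists_isCompl
  exact ⟨Submodule.projection U C hC.symm,
    fun u hu => Submodule.projection_apply_left hC.symm ⟨u, hu⟩,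
    fun r hr => (Submodule.projection_apply_eq_zero_iff hC.symm).mpr (hRC hr)⟩

/-- The linear endomorphism `P ⊗ Q` of `A × B → K`. -/
def tensorEnd {K A B : Type*} [Field K]
    (P : (A → K) →ₗ[K] (A → K)) (Q : (B → K) →ₗ[K] (B → K)) :
    (A × B → K) →ₗ[K] (A × B → K) where
  toFun x p := P (fun a => Q (fun b => x (a, b)) p.2) p.1
  map_add' x y := by
    funext p
    have hQ (a : A) : Q (fun b => x (a, b) + y (a, b)) =
        Q (fun b => x (a, b)) + Q (fun b => y (a, b)) := map_add Q _ _
    simp only [Pi.add_apply, hQ]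
    exact congrFun (map_add P _ _) p.1
  map_smul' c x := by
    funext p
    have hQ (a : A) : Q (fun b => c • x (a, b)) = c • Q (fun b => x (a, b)) := map_smul Q c _
    simp only [Pi.smul_apply, hQ]
    exact congrFun (map_smul P c _) p.1

lemma tensorEnd_apply_mul {K A B : Type*} [Field K]
    (P : (A → K) →ₗ[K] (A → K)) (Q : (B → K) →ₗ[K] (B → K)) (u : A → K) (v : B → K) :
    tensorEnd P Q (fun p => u p.1 * v p.2) = fun p => P u p.1 * Q v p.2 := by
  funext p
  have hQ (a : A) : Q (fun b => u a * v b) = u a • Q v := map_smul Q (u a) v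
  have hP : P (fun a => u a * Q v p.2) = Q v p.2 • P u := by
    rw [← map_smul]
    congr 1
    funext a
    exact mul_comm _ _
  change P (fun a => Q (fun b => u a * v b) p.2) p.1 = _
  simp only [hQ, Pi.smul_apply, smul_eq_mul, hP]
  exact mul_comm _ _

/-- If `U₁ ∩ R₁ = 0` and `U₂ ∩ R₂ = 0`, then `U₁ ⊗ U₂` meets `R₁ ⊗ K^B + K^A ⊗ R₂` trivially. -/
lemma eq_zero_of_mem_span_mul_of_mem_span {K A B : Type*} [Field K]
    {U₁ R₁ : Submodule K (A → K)} {U₂ R₂ : Submodule K (B → K)}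
    (h₁ : U₁ ⊓ R₁ = ⊥) (h₂ : U₂ ⊓ R₂ = ⊥) {S : Set (A × B → K)}
    (hS : ∀ x ∈ S, ∃ a b, (a ∈ R₁ ∨ b ∈ R₂) ∧ x = fun p : A × B => a p.1 * b p.2)
    {x : A × B → K} (hxS : x ∈ Submodule.span K S)
    (hx : x ∈ Submodule.span K
      {x : A × B → K | ∃ u₁ ∈ U₁, ∃ u₂ ∈ U₂, x = fun p : A × B => u₁ p.1 * u₂ p.2}) :
    x = 0 := by
  obtain ⟨P, hPU, hPR⟩ := exists_linearMap_fix_of_inf_eq_bot h₁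
  obtain ⟨Q, hQU, hQR⟩ := exists_linearMap_fix_of_inf_eq_bot h₂
  have hfix : tensorEnd P Q x = (LinearMap.id : (A × B → K) →ₗ[K] (A × B → K)) x := by
    refine LinearMap.eqOn_span ?_ hx
    rintro _ ⟨u₁, hu₁, u₂, hu₂, rfl⟩
    rw [tensorEnd_apply_mul, hPU u₁ hu₁, hQU u₂ hu₂, LinearMap.id_apply]
  have hkill : tensorEnd P Q x = (0 : (A × B → K) →ₗ[K] (A × B → K)) x := by
    refine LinearMap.eqOn_span ?_ hxS
    intro z hz
    obtain ⟨a, b, hab, rfl⟩ := hS z hz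
    rw [tensorEnd_apply_mul]
    funext p
    rcases hab with ha | hb
    · simp [hPR a ha]
    · simp [hQR b hb]
  exact hfix.symm.trans hkill

theorem rowSpan_inter_tensor_complement {V₁ W₁ V₂ W₂ : Type*}
    [Fintype V₁] [Fintype W₁] [Fintype V₂] [Fintype W₂]
    [DecidableEq V₁] [DecidableEq W₁] [DecidableEq V₂] [DecidableEq W₂]
    (H₁ : Matrix W₁ V₁ (ZMod 2)) (H₂ : Matrix W₂ V₂ (ZMod 2))
    (U₁ : Submodule (ZMod 2) (V₁ → ZMod 2)) (U₂ : Submodule (ZMod 2) (V₂ → ZMod 2))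
    (U₁T : Submodule (ZMod 2) (W₁ → ZMod 2)) (U₂T : Submodule (ZMod 2) (W₂ → ZMod 2))
    (hU₁ : U₁ ⊓ Submodule.span (ZMod 2) (Set.range (fun w : W₁ => H₁ w)) = ⊥)
    (hU₂ : U₂ ⊓ Submodule.span (ZMod 2) (Set.range (fun w : W₂ => H₂ w)) = ⊥)
    (hU₁T : U₁T ⊓ Submodule.span (ZMod 2) (Set.range (fun v : V₁ => H₁.transpose v)) = ⊥)
    (hU₂T : U₂T ⊓ Submodule.span (ZMod 2) (Set.range (fun v : V₂ => H₂.transpose v)) = ⊥)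
    (y : (W₁ × W₂ ⊕ V₁ × V₂) → ZMod 2)
    (hy : y ∈ Submodule.span (ZMod 2)
      (Set.range (fun i : V₁ × W₂ ⊕ W₁ × V₂ => prodCheck H₁ H₂ i)))
    (hyW : (fun p : W₁ × W₂ => y (Sum.inl p)) ∈ Submodule.span (ZMod 2)
      {x : (W₁ × W₂) → ZMod 2 |
        ∃ u₁ ∈ U₁T, ∃ u₂ ∈ U₂T, x = fun p : W₁ × W₂ => u₁ p.1 * u₂ p.2})
    (hyV : (fun p : V₁ × V₂ => y (Sum.inr p)) ∈ Submodule.span (ZMod 2)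
      {x : (V₁ × V₂) → ZMod 2 |
        ∃ u₁ ∈ U₁, ∃ u₂ ∈ U₂, x = fun p : V₁ × V₂ => u₁ p.1 * u₂ p.2}) :
    y = 0 := by
  have hyl := Submodule.mem_map_of_mem
    (f := LinearMap.funLeft (ZMod 2) (ZMod 2) (Sum.inl : W₁ × W₂ → W₁ × W₂ ⊕ V₁ × V₂)) hy
  have hyr := Submodule.mem_map_of_mem
    (f := LinearMap.funLeft (ZMod 2) (ZMod 2) (Sum.inr : V₁ × V₂ → W₁ × W₂ ⊕ V₁ × V₂)) hy
  rw [Submodule.map_span] at hyl hyr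
  have hl := eq_zero_of_mem_span_mul_of_mem_span hU₁T hU₂T (by
    rintro _ ⟨_, ⟨⟨v, w⟩ | ⟨w, v⟩, rfl⟩, rfl⟩
    · refine ⟨H₁.transpose v, Pi.single w 1, Or.inl (Submodule.subset_span ⟨v, rfl⟩), ?_⟩
      funext p
      simp [LinearMap.funLeft_apply, prodCheck, Pi.single_apply, eq_comm]
    · refine ⟨Pi.single w 1, H₂.transpose v, Or.inr (Submodule.subset_span ⟨v, rfl⟩), ?_⟩
      funext p
      simp [LinearMap.funLeft_apply, prodCheck, Pi.single_apply, eq_comm]) hyl hyW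
  have hr := eq_zero_of_mem_span_mul_of_mem_span hU₁ hU₂ (by
    rintro _ ⟨_, ⟨⟨v, w⟩ | ⟨w, v⟩, rfl⟩, rfl⟩
    · refine ⟨Pi.single v 1, H₂ w, Or.inr (Submodule.subset_span ⟨w, rfl⟩), ?_⟩
      funext p
      simp [LinearMap.funLeft_apply, prodCheck, Pi.single_apply, eq_comm]
    · refine ⟨H₁ w, Pi.single v 1, Or.inl (Submodule.subset_span ⟨w, rfl⟩), ?_⟩
      funext p
      simp [LinearMap.funLeft_apply, prodCheck, Pi.single_apply, eq_comm]) hyr hyV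
  funext j
  rcases j with p | p
  · exact congrFun hl p
  · exact congrFun hr p
end

section
/- Let n, r, t, s be nonnegative integers with t ≥ 1, let j ∈ [n], and let Γ₁,…,Γ_t be subsets of [n] such that j ∈ Γ_α and |Γ_α| = r+1 for every α, |Γ_{α} ∩ Γ_{β}| = s+1 for all distinct α, β ∈ [t], and Γ_{α} ∩ Γ_{β} ∩ Γ_{γ} = {j} for all pairwise distinct α, β, γ ∈ [t]. Then the number of permutations π of [n] for which there exists at least one α ∈ [t] with π(i) > π(j) for every i ∈ Γ_α∖{j} equals n!·p_e(r,t,s) (as an equality of rational numbers). -/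
/-- `p_e(r,t,s) = Σ_{L=1}^{t} (−1)^{L+1}·C(t,L)/N_e(r,L,s)`. -/
def pe (r t s : ℕ) : ℚ :=
  ∑ L ∈ Finset.Icc 1 t, (-1 : ℚ) ^ (L + 1) * (t.choose L : ℚ) / NeQ r L s

open Finset

/-- The permutations of `Fin n` at which `j` is a strict minimum on `insert j T`. -/
def strictMinPerms {n : ℕ} (j : Fin n) (T : Finset (Fin n)) : Finset (Equiv.Perm (Fin n)) :=
  univ.filter fun π => ∀ i ∈ T, i ≠ j → π j < π i

lemma mem_strictMinPerms {n : ℕ} {j : Fin n} {T : Finset (Fin n)} {π : Equiv.Perm (Fin n)} :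
    π ∈ strictMinPerms j T ↔ ∀ i ∈ T, i ≠ j → π j < π i := by
  simp [strictMinPerms]

/-- Composing with a transposition moves the minimum from one element of `T` to another. -/
lemma card_strictMinPerms_eq {n : ℕ} {T : Finset (Fin n)} {j k : Fin n} (hj : j ∈ T)
    (hk : k ∈ T) : (strictMinPerms k T).card = (strictMinPerms j T).card := by
  have key : ∀ a ∈ T, ∀ b ∈ T, ∀ π ∈ strictMinPerms a T,
      π * Equiv.swap a b ∈ strictMinPerms b T := by
    intro a ha b hb π hπ
    rw [mem_strictMinPerms] at hπ ⊢
    intro i hi hib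
    rw [Equiv.Perm.mul_apply, Equiv.Perm.mul_apply, Equiv.swap_apply_right]
    by_cases hia : i = a
    · subst hia
      rw [Equiv.swap_apply_left]
      exact hπ b hb (Ne.symm hib)
    · rw [Equiv.swap_apply_of_ne_of_ne hia hib]
      exact hπ i hi hia
  refine Finset.card_bij' (fun π _ => π * Equiv.swap k j) (fun π _ => π * Equiv.swap j k)
    (key k hk j hj) (key j hj k hk) ?_ ?_
  · intro π _
    simp [mul_assoc, Equiv.swap_comm j k]
  · intro π _
    simp [mul_assoc, Equiv.swap_comm j k]

lemma card_mul_card_strictMinPerms {n : ℕ} {T : Finset (Fin n)} {j : Fin n} (hj : j ∈ T) :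
    T.card * (strictMinPerms j T).card = n.factorial := by
  have hdisj : (T : Set (Fin n)).PairwiseDisjoint fun k => strictMinPerms k T := by
    intro a ha b hb hab
    refine Finset.disjoint_left.2 fun π h₁ h₂ => ?_
    rw [mem_strictMinPerms] at h₁ h₂
    exact lt_asymm (h₁ b hb hab.symm) (h₂ a ha hab)
  have hunion : T.biUnion (fun k => strictMinPerms k T) = univ := by
    refine eq_univ_iff_forall.2 fun π => ?_
    obtain ⟨k, hk, hmin⟩ := T.exists_min_image π ⟨j, hj⟩
    refine mem_biUnion.2 ⟨k, hk, mem_strictMinPerms.2 fun i hi hik => ?_⟩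
    exact lt_of_le_of_ne (hmin i hi) fun h => hik (π.injective h).symm
  have h := Finset.card_biUnion hdisj
  rw [hunion, sum_congr rfl fun k hk => card_strictMinPerms_eq hj hk, sum_const, smul_eq_mul,
    card_univ, Fintype.card_perm, Fintype.card_fin] at h
  exact h.symm

/-- The size of a union of sets in which every point lies in at most two of the sets. -/
lemma card_biUnion_of_triple_inter_empty {ι β : Type*} [DecidableEq ι] [DecidableEq β]
    (A : ι → Finset β) (r s : ℕ) (hr : ∀ a, (A a).card = r)
    (hs : ∀ a b, a ≠ b → (A a ∩ A b).card = s)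
    (h₃ : ∀ a b c, a ≠ b → a ≠ c → b ≠ c → A a ∩ A b ∩ A c = ∅) (S : Finset ι) :
    ((S.biUnion A).card : ℚ) = S.card * r - s * S.card * (S.card - 1) / 2 := by
  induction S using Finset.induction_on with
  | empty => simp
  | insert a S ha ih =>
    have hne : ∀ b ∈ S, a ≠ b := fun b hb h => ha (h ▸ hb)
    have hinter : (A a ∩ S.biUnion A).card = S.card * s := by
      rw [inter_biUnion, card_biUnion, sum_congr rfl fun b hb => hs a b (hne b hb), sum_const,
        smul_eq_mul]
      intro b hb c hc hbc
      rw [Function.onFun, disjoint_iff_inter_eq_empty, ← inter_inter_distrib_left, ← inter_assoc]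
      exact h₃ a b c (hne b hb) (hne c hc) hbc
    have h := card_union_add_card_inter (A a) (S.biUnion A)
    rw [hinter, hr, ← biUnion_insert] at h
    have h' : (((insert a S).biUnion A).card : ℚ) + S.card * s = r + (S.biUnion A).card := by
      exact_mod_cast h
    rw [card_insert_of_notMem ha]
    push_cast
    linarith

theorem count_good_permutations_exact (n r t s : ℕ) (ht : 1 ≤ t)
    (j : Fin n) (Γ : Fin t → Finset (Fin n))
    (hmem : ∀ α, j ∈ Γ α) (hcard : ∀ α, (Γ α).card = r + 1)
    (hpair : ∀ α β : Fin t, α ≠ β → (Γ α ∩ Γ β).card = s + 1)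
    (htriple : ∀ α β γ : Fin t, α ≠ β → α ≠ γ → β ≠ γ →
      Γ α ∩ Γ β ∩ Γ γ = {j}) :
    (((Finset.univ : Finset (Equiv.Perm (Fin n))).filter
        (fun π : Equiv.Perm (Fin n) =>
          ∃ α : Fin t, ∀ i ∈ Γ α, i ≠ j → π j < π i)).card : ℚ)
      = (n.factorial : ℚ) * pe r t s := by
  classical
  set A : Fin t → Finset (Fin n) := fun α => (Γ α).erase j with hA
  have hinf : ∀ S : Finset (Fin t),
      S.inf (fun α => strictMinPerms j (Γ α)) = strictMinPerms j (insert j (S.biUnion A)) := by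
    intro S
    ext π
    simp only [mem_inf, mem_strictMinPerms, hA, mem_insert, mem_biUnion, mem_erase]
    constructor
    · rintro h i (rfl | ⟨α, hα, -, hi⟩) hij
      · exact absurd rfl hij
      · exact h α hα i hi hij
    · exact fun h α hα i hi hij => h i (Or.inr ⟨α, hα, hij, hi⟩) hij
  have hcount : ∀ S : Finset (Fin t),
      ((S.inf fun α => strictMinPerms j (Γ α)).card : ℚ) = n.factorial / NeQ r S.card s := by
    intro S
    have hN : ((insert j (S.biUnion A)).card : ℚ) = NeQ r S.card s := by
      rw [card_insert_of_notMem (by simp [hA])]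
      push_cast
      rw [card_biUnion_of_triple_inter_empty A r s, NeQ]
      · ring
      · intro a
        rw [hA, card_erase_of_mem (hmem a), hcard, Nat.add_sub_cancel]
      · intro a b hab
        have : A a ∩ A b = (Γ a ∩ Γ b).erase j := by
          ext
          simp only [hA, mem_inter, mem_erase]
          tauto
        rw [this, card_erase_of_mem (mem_inter.2 ⟨hmem a, hmem b⟩), hpair a b hab,
          Nat.add_sub_cancel]
      · intro a b c hab hac hbc
        have : A a ∩ A b ∩ A c = (Γ a ∩ Γ b ∩ Γ c).erase j := by
          ext
          simp only [hA, mem_inter, mem_erase]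
          tauto
        rw [this, htriple a b c hab hac hbc, erase_singleton]
    have hmul := card_mul_card_strictMinPerms (mem_insert_self j (S.biUnion A))
    have hpos : ((insert j (S.biUnion A)).card : ℚ) ≠ 0 :=
      Nat.cast_ne_zero.2 (card_ne_zero_of_mem (mem_insert_self j _))
    rw [hinf, ← hN, eq_div_iff hpos, mul_comm]
    exact_mod_cast hmul
  have hie := inclusion_exclusion_card_inf_compl univ fun α => strictMinPerms j (Γ α)
  have hie' : (((univ.inf fun α => (strictMinPerms j (Γ α))ᶜ).card : ℕ) : ℚ) =
      ∑ L ∈ range (t + 1), (t.choose L : ℚ) * ((-1) ^ L * (n.factorial / NeQ r L s)) := by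
    have h : (((univ.inf fun α => (strictMinPerms j (Γ α))ᶜ).card : ℤ) : ℚ) =
        ∑ S ∈ (univ : Finset (Fin t)).powerset,
          (-1) ^ S.card * (n.factorial / NeQ r S.card s) := by
      rw [hie]
      push_cast
      exact sum_congr rfl fun S _ => by rw [hcount]
    rw [sum_powerset_apply_card (fun L => (-1 : ℚ) ^ L * (n.factorial / NeQ r L s))] at h
    simpa [nsmul_eq_mul] using h
  have hcompl : (univ.filter fun π : Equiv.Perm (Fin n) =>
      ∃ α : Fin t, ∀ i ∈ Γ α, i ≠ j → π j < π i)ᶜ =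
      univ.inf fun α => (strictMinPerms j (Γ α))ᶜ := by
    ext π
    simp only [mem_compl, mem_filter_univ, mem_inf, mem_strictMinPerms, mem_univ, true_imp_iff,
      not_exists]
  have htot := card_add_card_compl (univ.filter fun π : Equiv.Perm (Fin n) =>
      ∃ α : Fin t, ∀ i ∈ Γ α, i ≠ j → π j < π i)
  rw [hcompl, Fintype.card_perm, Fintype.card_fin] at htot
  have htotQ := congrArg (Nat.cast : ℕ → ℚ) htot
  rw [Nat.cast_add, hie', range_eq_Ico, sum_eq_sum_Ico_succ_bot (Nat.succ_pos t)] at htotQ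
  rw [eq_sub_of_add_eq htotQ, pe, mul_sum, zero_add, Nat.succ_eq_add_one, Ico_add_one_right_eq_Icc]
  have hneg : ∑ L ∈ Icc 1 t, (n.factorial : ℚ) * ((-1) ^ (L + 1) * (t.choose L : ℚ) / NeQ r L s) =
      -∑ L ∈ Icc 1 t, (t.choose L : ℚ) * ((-1) ^ L * (n.factorial / NeQ r L s)) := by
    rw [← sum_neg_distrib]
    exact sum_congr rfl fun L _ => by ring
  rw [hneg]
  simp [NeQ]
end

section
/- Let n, r, t, s be positive integers, let j ∈ [n], and let Γ₁,…,Γ_t be subsets of [n] with j ∈ Γ_α for every α, such that for every nonempty subset S ⊆ [t] one has N̲(r,|S|,s) ≤ |⋃_{α∈S} Γ_α| ≤ N̄(r,|S|,s) (as holds, by a result of Kruglik–Frolov, when each |Γ_α| ≤ r+1 and |Γ_α ∩ Γ_β| ≤ s+1 for α ≠ β). Then the number of permutations π of [n] for which there exists at least one α ∈ [t] with π(i) > π(j) for every i ∈ Γ_α∖{j} is at least n!·p₂(r,t,s) (as an inequality of rational numbers). -/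
/-- `x := min{L, ⌊r/s⌋+1}`. -/
def xval (r s L : ℕ) : ℕ := min L (r / s + 1)

/-- `N̲(r,L,s) = x(2r−(x−1)s)/2 + 1` where `x = min{L, ⌊r/s⌋+1}`. -/
def Nlow (r L s : ℕ) : ℚ :=
  (xval r s L : ℚ) * (2 * (r : ℚ) - ((xval r s L : ℚ) - 1) * (s : ℚ)) / 2 + 1

/-- `N̄(r,L,s) = Lr + 1`. -/
def Nhigh (r L s : ℕ) : ℚ := (L : ℚ) * (r : ℚ) + 1

/-- `p₂(r,t,s) = Σ_{L odd} C(t,L)/N̄(r,L,s) − Σ_{L even} C(t,L)/N̲(r,L,s)`,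
sums over `1 ≤ L ≤ t`. -/
def p2 (r t s : ℕ) : ℚ :=
  ∑ L ∈ (Finset.Icc 1 t).filter (fun L => L % 2 = 1), (t.choose L : ℚ) / Nhigh r L s
  - ∑ L ∈ (Finset.Icc 1 t).filter (fun L => L % 2 = 0), (t.choose L : ℚ) / Nlow r L s

section PermMin

variable {α : Type*} [Fintype α] [LinearOrder α]

/-- The permutations of `α` attaining their strict minimum on `insert j U` at `j`. -/
def permsMinAt (U : Finset α) (j : α) : Finset (Equiv.Perm α) :=
  Finset.univ.filter fun π => ∀ i ∈ U, i ≠ j → π j < π i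

theorem mem_permsMinAt {U : Finset α} {j : α} {π : Equiv.Perm α} :
    π ∈ permsMinAt U j ↔ ∀ i ∈ U, i ≠ j → π j < π i := by
  simp [permsMinAt]

theorem card_permsMinAt_eq {U : Finset α} {j k : α} (hj : j ∈ U) (hk : k ∈ U) :
    (permsMinAt U j).card = (permsMinAt U k).card := by
  have key : ∀ {j k : α}, j ∈ U → k ∈ U → ∀ π ∈ permsMinAt U j,
      π * Equiv.swap j k ∈ permsMinAt U k := by
    intro j k hj hk π hπ
    rw [mem_permsMinAt] at hπ ⊢
    intro i hi hik
    rw [Equiv.Perm.mul_apply, Equiv.Perm.mul_apply, Equiv.swap_apply_right]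
    refine hπ _ ?_ ?_
    · rw [Equiv.swap_apply_def]
      split_ifs <;> assumption
    · rw [Ne, Equiv.swap_apply_eq_iff, Equiv.swap_apply_left]
      exact hik
  refine Finset.card_nbij' (· * Equiv.swap j k) (· * Equiv.swap j k) (key hj hk) ?_ ?_ ?_
  · intro π hπ
    simpa [Equiv.swap_comm] using key hk hj π hπ
  · intro π _
    simp [mul_assoc]
  · intro π _
    simp [mul_assoc]

theorem card_mul_card_permsMinAt {U : Finset α} {j : α} (hj : j ∈ U) :
    U.card * (permsMinAt U j).card = (Fintype.card α).factorial := by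
  have hunion : U.biUnion (permsMinAt U) = Finset.univ := by
    refine Finset.eq_univ_iff_forall.2 fun π => ?_
    obtain ⟨k, hk, hmin⟩ := U.exists_min_image π ⟨j, hj⟩
    refine Finset.mem_biUnion.2 ⟨k, hk, mem_permsMinAt.2 fun i hi hik => ?_⟩
    exact lt_of_le_of_ne (hmin i hi) fun h => hik (π.injective h).symm
  have hdisj : (U : Set α).PairwiseDisjoint (permsMinAt U) := by
    intro a ha b hb hab
    refine Finset.disjoint_left.2 fun π hπa hπb => ?_
    exact lt_asymm (mem_permsMinAt.1 hπa b hb hab.symm) (mem_permsMinAt.1 hπb a ha hab)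
  rw [← Fintype.card_perm, ← Finset.card_univ, ← hunion, Finset.card_biUnion hdisj,
    Finset.sum_congr rfl fun k hk => card_permsMinAt_eq hk hj, Finset.sum_const, smul_eq_mul]

theorem card_permsMinAt {U : Finset α} {j : α} (hj : j ∈ U) :
    ((permsMinAt U j).card : ℚ) = (Fintype.card α).factorial / U.card := by
  have hU : (U.card : ℚ) ≠ 0 := Nat.cast_ne_zero.2 (Finset.card_ne_zero_of_mem hj)
  rw [eq_div_iff hU, mul_comm]
  exact_mod_cast card_mul_card_permsMinAt hj

theorem inf'_permsMinAt {ι : Type*} (S : Finset ι) (hS : S.Nonempty) (Γ : ι → Finset α) (j : α) :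
    S.inf' hS (fun a => permsMinAt (Γ a) j) = permsMinAt (S.biUnion Γ) j := by
  ext π
  simp only [Finset.mem_inf', mem_permsMinAt, Finset.mem_biUnion]
  exact ⟨fun h i ⟨a, ha, hi⟩ => h a ha i hi, fun h a ha i hi => h i ⟨a, ha, hi⟩⟩

end PermMin

theorem Nlow_pos {r L s : ℕ} (hr : 0 < r) (hL : 0 < L) : 0 < Nlow r L s := by
  have h1 : 1 ≤ xval r s L := le_min hL (Nat.le_add_left 1 _)
  have h2 : xval r s L ≤ r / s + 1 := min_le_right _ _
  have h3 : xval r s L * s ≤ r + s := by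
    calc xval r s L * s ≤ (r / s + 1) * s := Nat.mul_le_mul_right s h2
      _ = r / s * s + s := by ring
      _ ≤ r + s := Nat.add_le_add_right (Nat.div_mul_le_self r s) s
  have h4 : (xval r s L : ℚ) * s ≤ r + s := by exact_mod_cast h3
  have hr' : (0 : ℚ) < r := by exact_mod_cast hr
  have h5 : (0 : ℚ) ≤ 2 * r - (xval r s L - 1) * s := by linarith
  unfold Nlow
  positivity

/-- The signed reciprocal bound contributed to `p2` by an index set of size `L`. -/
def p2Term (r s L : ℕ) : ℚ :=
  if L % 2 = 1 then 1 / Nhigh r L s else -(1 / Nlow r L s)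

theorem p2_eq_sum (r t s : ℕ) :
    p2 r t s = ∑ S ∈ (Finset.univ : Finset (Fin t)).powerset.filter (·.Nonempty),
      p2Term r s S.card := by
  have hpow : ∑ S ∈ (Finset.univ : Finset (Fin t)).powerset,
      (if S.card = 0 then 0 else p2Term r s S.card) =
      ∑ L ∈ Finset.range (t + 1), t.choose L • (if L = 0 then 0 else p2Term r s L) := by
    simpa using Finset.sum_powerset_apply_card
      (x := (Finset.univ : Finset (Fin t)))
      (fun L => if L = 0 then 0 else p2Term r s L)
  have hleft : ∑ S ∈ (Finset.univ : Finset (Fin t)).powerset.filter (·.Nonempty),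
      p2Term r s S.card = ∑ S ∈ (Finset.univ : Finset (Fin t)).powerset,
      (if S.card = 0 then 0 else p2Term r s S.card) := by
    rw [Finset.sum_filter]
    refine Finset.sum_congr rfl fun S _ => ?_
    rcases S.eq_empty_or_nonempty with rfl | hS
    · simp
    · rw [if_pos hS, if_neg hS.card_ne_zero]
  rw [hleft, hpow, Finset.sum_range_succ', if_pos rfl, smul_zero, add_zero, p2,
    Finset.sum_filter, Finset.sum_filter, ← Finset.sum_sub_distrib,
    Finset.range_eq_Ico, Finset.sum_Ico_add' (fun L => t.choose L •
      (if L = 0 then (0 : ℚ) else p2Term r s L)) 0 t 1]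
  refine Finset.sum_congr (by ext; simp) fun L hL => ?_
  have hL0 : L ≠ 0 := by
    have := (Finset.mem_Ico.1 hL).1
    omega
  rw [if_neg hL0, p2Term, nsmul_eq_mul]
  rcases Nat.mod_two_eq_zero_or_one L with h | h <;> simp [h, div_eq_mul_inv]

theorem count_good_permutations_lower_bound (n r t s : ℕ)
    (hn : 0 < n) (hr : 0 < r) (ht : 0 < t) (hs : 0 < s)
    (j : Fin n) (Γ : Fin t → Finset (Fin n))
    (hmem : ∀ α, j ∈ Γ α)
    (hbound : ∀ S : Finset (Fin t), S.Nonempty →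
      Nlow r S.card s ≤ ((S.biUnion Γ).card : ℚ) ∧
      ((S.biUnion Γ).card : ℚ) ≤ Nhigh r S.card s) :
    (n.factorial : ℚ) * p2 r t s ≤
      (((Finset.univ : Finset (Equiv.Perm (Fin n))).filter
        (fun π : Equiv.Perm (Fin n) =>
          ∃ α : Fin t, ∀ i ∈ Γ α, i ≠ j → π j < π i)).card : ℚ) := by
  have hset : (Finset.univ.filter fun π : Equiv.Perm (Fin n) =>
      ∃ α : Fin t, ∀ i ∈ Γ α, i ≠ j → π j < π i) =
      Finset.univ.biUnion fun α => permsMinAt (Γ α) j := by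
    ext π
    simp [mem_permsMinAt]
  have hincl := congrArg (Int.cast : ℤ → ℚ) (Finset.inclusion_exclusion_card_biUnion
    (Finset.univ : Finset (Fin t)) fun α => permsMinAt (Γ α) j)
  simp only [inf'_permsMinAt] at hincl
  push_cast at hincl
  rw [hset, hincl, p2_eq_sum, Finset.mul_sum, ← Finset.sum_coe_sort]
  refine Finset.sum_le_sum fun S _ => ?_
  obtain ⟨S, hmemS⟩ := S
  have hS : S.Nonempty := (Finset.mem_filter.1 hmemS).2
  obtain ⟨hlow, hhigh⟩ := hbound S hS
  have hlow_pos := Nlow_pos (s := s) hr hS.card_pos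
  have hj : j ∈ S.biUnion Γ := Finset.mem_biUnion.2 ⟨_, hS.choose_spec, hmem _⟩
  simp only [card_permsMinAt hj, Fintype.card_fin, p2Term]
  have hfact : (0 : ℚ) ≤ n.factorial := Nat.cast_nonneg _
  split_ifs with hodd
  · rw [(Nat.odd_iff.2 hodd).add_one.neg_one_pow, one_mul, mul_one_div]
    exact div_le_div_of_nonneg_left hfact (hlow_pos.trans_le hlow) hhigh
  · rw [(Nat.not_odd_iff_even.1 (mt Nat.odd_iff.1 hodd)).add_one.neg_one_pow, neg_one_mul,
      mul_neg, mul_one_div]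
    exact neg_le_neg (div_le_div_of_nonneg_left hfact hlow_pos hlow)
end
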